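/- arXiv:1704.03195 — 2 statements merged into one kernel-verified Lean document; each statement's English description precedes it below -/
import Mathlib

section
/- Rigidity in the isoperimetric inequality: let n ≥ 1, R > 0, r > 0 and let E ⊆ ℝⁿ be measurable with Lⁿ(E) = Lⁿ(B_R) and Per_r(E) = Per_r(B_R), where B_R denotes the open ball of radius R centered at the origin. Then there exists p ∈ ℝⁿ such that Lⁿ(E Δ B_R(p)) = 0, i.e. E coincides with a ball of radius R up to a set of Lebesgue measure zero. -/
open MeasureTheory Metric Set Filter Topology
open scoped RealInnerProductSpace ENNReal

noncomputable section

/-- The set of points of Lebesgue density one of `E`. -/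
def densityOnePoints (n : ℕ) (E : Set (EuclideanSpace ℝ (Fin n))) :
    Set (EuclideanSpace ℝ (Fin n)) :=
  {x | Tendsto (fun ρ : ℝ => volume (E ∩ ball x ρ) / volume (ball x ρ)) (𝓝[>] 0) (𝓝 1)}

/-- The `r`-perimeter `Per_r(E, Ω) = (1/(2r)) Lⁿ((∂E ⊕ B_r) ∩ Ω)`, where `E` is identified with
its points of density one, `∂E` is the topological boundary of that set, and
`A ⊕ B_r` is the open `r`-neighbourhood of `A`. -/
def perR (n : ℕ) (r : ℝ) (E Ω : Set (EuclideanSpace ℝ (Fin n))) : ℝ≥0∞ :=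
  volume (Metric.thickening r (frontier (densityOnePoints n E)) ∩ Ω) / ENNReal.ofReal (2 * r)

lemma bm_one {A B C : Set ℝ} (hA : MeasurableSet A) (hB : MeasurableSet B)
    (hAn : A.Nonempty) (hBn : B.Nonempty) (hC : ∀ a ∈ A, ∀ b ∈ B, a + b ∈ C) :
    volume A + volume B ≤ volume C := by
  have key : ∀ K L : Set ℝ, IsCompact K → IsCompact L → K.Nonempty → L.Nonempty → K ⊆ A → L ⊆ B →
      volume K + volume L ≤ volume C := by
    intro K L hK hL hKn hLn hKA hLB
    obtain ⟨k, hk, hkmax⟩ := hK.exists_isGreatest hKn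
    obtain ⟨l, hl, hlmin⟩ := hL.exists_isLeast hLn
    have h1 : volume ((fun x => x + l) '' K) = volume K := by
      simp [Set.image_add_right]
    have h2 : volume ((fun x => k + x) '' L) = volume L := by
      simp [Set.image_add_left]
    rw [← h1, ← h2, ← measure_union₀]
    · apply measure_mono
      rintro x (⟨y, hy, rfl⟩ | ⟨y, hy, rfl⟩)
      · exact hC _ (hKA hy) _ (hLB hl)
      · exact hC _ (hKA hk) _ (hLB hy)
    · exact (hL.image (by fun_prop)).measurableSet.nullMeasurableSet
    · refine measure_mono_null (t := {k + l}) ?_ (by simp)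
      rintro x ⟨⟨y, hy, rfl⟩, ⟨z, hz, hzy⟩⟩
      have := hkmax hy
      have := hlmin hz
      simp only [mem_singleton_iff] at *
      linarith
  have single : ∀ A : Set ℝ, MeasurableSet A → A.Nonempty →
      volume A ≤ ⨆ K : {K : Set ℝ // IsCompact K ∧ K.Nonempty ∧ K ⊆ A}, volume K.1 := by
    intro A hA _
    refine le_of_forall_lt fun r hr => ?_
    obtain ⟨K, hKA, hK, h⟩ := hA.exists_lt_isCompact hr
    exact h.trans_le (le_iSup_of_le ⟨K, hK, nonempty_of_measure_ne_zero (ne_bot_of_gt h), hKA⟩ le_rfl)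
  have ne : ∀ A : Set ℝ, A.Nonempty → Nonempty {K : Set ℝ // IsCompact K ∧ K.Nonempty ∧ K ⊆ A} := by
    rintro A ⟨a, ha⟩
    exact ⟨⟨{a}, isCompact_singleton, by simp, by simpa using ha⟩⟩
  have := ne A hAn
  have := ne B hBn
  refine (add_le_add (single A hA hAn) (single B hB hBn)).trans ?_
  refine ENNReal.iSup_add_iSup_le ?_
  rintro ⟨K, hK, hKn, hKA⟩ ⟨L, hL, hLn, hLB⟩
  exact key K L hK hL hKn hLn hKA hLB

lemma amgm_ennreal (a b : ℝ≥0∞) {t : ℝ} (h0 : 0 < t) (h1 : t < 1) :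
    a ^ (1 - t) * b ^ t ≤ ENNReal.ofReal (1 - t) * a + ENNReal.ofReal t * b := by
  have ht' : 0 < 1 - t := by linarith
  rcases eq_or_ne a ∞ with rfl | ha
  · rw [ENNReal.mul_top (by simpa using h1)]; simp
  rcases eq_or_ne b ∞ with rfl | hb
  · rw [ENNReal.mul_top (by simpa using h0)]; simp
  lift a to NNReal using ha
  lift b to NNReal using hb
  have := NNReal.geom_mean_le_arith_mean2_weighted (1 - t).toNNReal t.toNNReal a b (by
    rw [← Real.toNNReal_add ht'.le h0.le]; simp)
  rw [Real.coe_toNNReal _ ht'.le, Real.coe_toNNReal _ h0.le] at this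
  rw [← ENNReal.coe_rpow_of_nonneg _ ht'.le, ← ENNReal.coe_rpow_of_nonneg _ h0.le]
  unfold ENNReal.ofReal
  exact_mod_cast this

/-- Normalised one-dimensional Prekopa-Leindler. -/
lemma pl_one_aux {t : ℝ} (h0 : 0 < t) (h1 : t < 1) {f g h : ℝ → ℝ≥0∞} (hf : Measurable f)
    (hg : Measurable g) (hh : Measurable h) (hfs : ⨆ x, f x = 1) (hgs : ⨆ x, g x = 1)
    (H : ∀ x y, f x ^ (1 - t) * g y ^ t ≤ h ((1 - t) * x + t * y)) :
    ENNReal.ofReal (1 - t) * (∫⁻ x, f x) + ENNReal.ofReal t * (∫⁻ x, g x) ≤ ∫⁻ x, h x := by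
  have ht' : 0 < 1 - t := by linarith
  have hf1 : ∀ x, f x ≤ 1 := fun x => hfs ▸ le_iSup f x
  have hg1 : ∀ x, g x ≤ 1 := fun x => hgs ▸ le_iSup g x
  have lc : ∀ u : ℝ → ℝ≥0∞, Measurable u → (∀ x, u x ≤ 1) →
      ∫⁻ x, u x = ∫⁻ l in Ioo (0:ℝ) 1, volume {x | ENNReal.ofReal l < u x} := by
    intro u hu hu1
    have e1 : ∀ x, u x = ENNReal.ofReal (u x).toReal := fun x =>
      (ENNReal.ofReal_toReal (ne_top_of_le_ne_top (by simp) (hu1 x))).symm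
    rw [lintegral_congr e1, lintegral_eq_lintegral_meas_lt volume
      (Eventually.of_forall fun x => ENNReal.toReal_nonneg) hu.ennreal_toReal.aemeasurable]
    rw [← Ioo_union_Ici_eq_Ioi (zero_lt_one (α := ℝ)), lintegral_union measurableSet_Ici
      (by rw [Set.disjoint_left]; intro x hx hx'; exact absurd hx.2 (not_lt.2 hx'))]
    have : ∫⁻ l in Ici (1:ℝ), volume {a | l < (u a).toReal} = 0 := by
      rw [setLIntegral_congr_fun (g := fun _ => 0) measurableSet_Ici]
      · simp
      intro l hl
      have : {a | l < (u a).toReal} = ∅ := by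
        ext a
        have : (u a).toReal ≤ 1 := ENNReal.toReal_le_of_le_ofReal zero_le_one (by simpa using hu1 a)
        simp only [mem_ofPred_eq, mem_empty_iff_false, iff_false, not_lt]
        exact this.trans hl
      simp [this]
    rw [this, add_zero]
    refine setLIntegral_congr_fun measurableSet_Ioo fun l hl => ?_
    congr 1
    ext x
    simp only [mem_ofPred_eq]
    rw [ENNReal.ofReal_lt_iff_lt_toReal hl.1.le (ne_top_of_le_ne_top (by simp) (hu1 x))]
  have hmh : Measurable fun x => min (h x) 1 := hh.min measurable_const
  have anti : ∀ u : ℝ → ℝ≥0∞, Antitone fun l : ℝ => volume {x | ENNReal.ofReal l < u x} := by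
    intro u l l' hl
    exact measure_mono fun x (hx : _ < _) => (ENNReal.ofReal_le_ofReal hl).trans_lt hx
  calc _ = ∫⁻ l in Ioo (0:ℝ) 1, (ENNReal.ofReal (1 - t) * volume {x | ENNReal.ofReal l < f x}
        + ENNReal.ofReal t * volume {x | ENNReal.ofReal l < g x}) := by
        rw [lintegral_add_left ((anti f).measurable.const_mul _), lintegral_const_mul _ (anti f).measurable,
          lintegral_const_mul _ (anti g).measurable, lc f hf hf1, lc g hg hg1]
    _ ≤ ∫⁻ l in Ioo (0:ℝ) 1, volume {x | ENNReal.ofReal l < min (h x) 1} := by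
        refine setLIntegral_mono' measurableSet_Ioo fun l hl => ?_
        have hl1 : ENNReal.ofReal l < 1 := by simpa using hl.2
        have nf : ∃ x, ENNReal.ofReal l < f x := by
          rw [← hfs] at hl1; exact lt_iSup_iff.1 hl1
        have ng : ∃ x, ENNReal.ofReal l < g x := by
          rw [← hgs] at hl1; exact lt_iSup_iff.1 hl1
        have sc : ∀ (c : ℝ), 0 < c → ∀ A : Set ℝ, ENNReal.ofReal c * volume A
            = volume ((fun x => c * x) '' A) := by
          intro c hc A
          have := Measure.addHaar_smul (volume : Measure ℝ) c A
          simp only [Module.finrank_self, pow_one, abs_of_pos hc] at this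
          rw [← this]; rfl
        rw [sc _ ht', sc _ h0]
        have ms : ∀ (c : ℝ), 0 < c → ∀ A : Set ℝ, MeasurableSet A →
            MeasurableSet ((fun x => c * x) '' A) := by
          intro c hc A hA
          exact (measurableEmbedding_mulLeft₀ hc.ne').measurableSet_image' hA
        refine bm_one (ms _ ht' _ (measurableSet_lt measurable_const hf))
          (ms _ h0 _ (measurableSet_lt measurable_const hg)) (Nonempty.image _ nf)
          (Nonempty.image _ ng) ?_
        rintro _ ⟨x, hx, rfl⟩ _ ⟨y, hy, rfl⟩
        simp only [mem_ofPred_eq] at hx hy ⊢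
        refine lt_min (lt_of_lt_of_le ?_ (H x y)) hl1
        have hl0 : ENNReal.ofReal l ≠ 0 := by simpa using hl.1
        calc ENNReal.ofReal l = ENNReal.ofReal l ^ (1 - t) * ENNReal.ofReal l ^ t := by
              rw [← ENNReal.rpow_add _ _ hl0 (by simp)]; simp
          _ < _ := ENNReal.mul_lt_mul (ENNReal.rpow_lt_rpow hx ht') (ENNReal.rpow_lt_rpow hy h0)
    _ = ∫⁻ x, min (h x) 1 := (lc _ hmh fun x => min_le_right _ _).symm
    _ ≤ _ := lintegral_mono fun x => min_le_left _ _

lemma pl_one_bdd {t : ℝ} (h0 : 0 < t) (h1 : t < 1) {f g h : ℝ → ℝ≥0∞} (hf : Measurable f)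
    (hg : Measurable g) (hh : Measurable h) (hfs : ⨆ x, f x ≠ ∞) (hgs : ⨆ x, g x ≠ ∞)
    (H : ∀ x y, f x ^ (1 - t) * g y ^ t ≤ h ((1 - t) * x + t * y)) :
    (∫⁻ x, f x) ^ (1 - t) * (∫⁻ x, g x) ^ t ≤ ∫⁻ x, h x := by
  have ht' : 0 < 1 - t := by linarith
  set a := ⨆ x, f x with ha
  set b := ⨆ x, g x with hb
  rcases eq_or_ne a 0 with a0 | a0
  · have : ∀ x, f x = 0 := by simpa [a0] using ha.symm
    simp [this, ht']
  rcases eq_or_ne b 0 with b0 | b0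
  · have : ∀ x, g x = 0 := by simpa [b0] using hb.symm
    simp [this, h0]
  set c := a ^ (1 - t) * b ^ t with hc
  have ap0 : a ^ (1 - t) ≠ 0 := (ENNReal.rpow_pos (pos_iff_ne_zero.2 a0) hfs).ne'
  have bp0 : b ^ t ≠ 0 := (ENNReal.rpow_pos (pos_iff_ne_zero.2 b0) hgs).ne'
  have apt : a ^ (1 - t) ≠ ∞ := ENNReal.rpow_ne_top_of_nonneg ht'.le hfs
  have bpt : b ^ t ≠ ∞ := ENNReal.rpow_ne_top_of_nonneg h0.le hgs
  have c0 : c ≠ 0 := mul_ne_zero ap0 bp0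
  have ct : c ≠ ∞ := ENNReal.mul_ne_top apt bpt
  have cinv : c⁻¹ = (a⁻¹) ^ (1 - t) * (b⁻¹) ^ t := by
    rw [hc, ENNReal.mul_inv (Or.inl ap0) (Or.inl apt), ENNReal.inv_rpow, ENNReal.inv_rpow]
  have := pl_one_aux h0 h1 (f := fun x => a⁻¹ * f x) (g := fun x => b⁻¹ * g x)
    (h := fun x => c⁻¹ * h x) (hf.const_mul _) (hg.const_mul _) (hh.const_mul _)
    (by rw [← ENNReal.mul_iSup, ← ha, ENNReal.inv_mul_cancel a0 hfs])
    (by rw [← ENNReal.mul_iSup, ← hb, ENNReal.inv_mul_cancel b0 hgs])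
    (by
      intro x y
      rw [ENNReal.mul_rpow_of_nonneg _ _ ht'.le, ENNReal.mul_rpow_of_nonneg _ _ h0.le, cinv,
        mul_mul_mul_comm]
      gcongr
      exact H x y)
  have := (amgm_ennreal _ _ h0 h1).trans this
  rw [lintegral_const_mul _ hf, lintegral_const_mul _ hg, lintegral_const_mul _ hh,
    ENNReal.mul_rpow_of_nonneg _ _ ht'.le, ENNReal.mul_rpow_of_nonneg _ _ h0.le,
    mul_mul_mul_comm, ← cinv] at this
  exact (ENNReal.mul_le_mul_iff_right (ENNReal.inv_ne_zero.2 ct) (ENNReal.inv_ne_top.2 c0)).1 this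

lemma pl_one {t : ℝ} (h0 : 0 < t) (h1 : t < 1) {f g h : ℝ → ℝ≥0∞} (hf : Measurable f)
    (hg : Measurable g) (hh : Measurable h)
    (H : ∀ x y, f x ^ (1 - t) * g y ^ t ≤ h ((1 - t) * x + t * y)) :
    (∫⁻ x, f x) ^ (1 - t) * (∫⁻ x, g x) ^ t ≤ ∫⁻ x, h x := by
  have ht' : 0 < 1 - t := by linarith
  have tr : ∀ u : ℝ → ℝ≥0∞, Measurable u →
      Tendsto (fun n : ℕ => ∫⁻ x, min (u x) n) atTop (𝓝 (∫⁻ x, u x)) := by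
    intro u hu
    refine lintegral_tendsto_of_tendsto_of_monotone (fun n => (hu.min measurable_const).aemeasurable)
      (Eventually.of_forall fun x n m hnm => min_le_min le_rfl (by exact_mod_cast hnm))
      (Eventually.of_forall fun x => ?_)
    have := (tendsto_const_nhds (x := u x)).min ENNReal.tendsto_nat_nhds_top
    simpa using this
  have b : ∀ n : ℕ, (∫⁻ x, min (f x) n) ^ (1 - t) * (∫⁻ x, min (g x) n) ^ t ≤ ∫⁻ x, h x := by
    intro n
    refine pl_one_bdd h0 h1 (hf.min measurable_const) (hg.min measurable_const) hh
      (ne_top_of_le_ne_top (ENNReal.natCast_ne_top n) (iSup_le fun x => min_le_right _ _))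
      (ne_top_of_le_ne_top (ENNReal.natCast_ne_top n) (iSup_le fun x => min_le_right _ _)) ?_
    intro x y
    refine le_trans ?_ (H x y)
    gcongr <;> exact min_le_left _ _
  rcases eq_or_ne (∫⁻ x, f x) 0 with f0 | f0
  · simp [f0, ht']
  rcases eq_or_ne (∫⁻ x, g x) 0 with g0 | g0
  · simp [g0, h0]
  refine le_of_tendsto' (ENNReal.Tendsto.mul ((tr f hf).ennrpow_const _) (Or.inl ?_)
    ((tr g hg).ennrpow_const _) (Or.inl ?_)) b
  · simp [ENNReal.rpow_eq_zero_iff, f0, ht', not_lt.2 ht'.le]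
  · simp [ENNReal.rpow_eq_zero_iff, g0, h0, not_lt.2 h0.le]

lemma pl_pi {t : ℝ} (h0 : 0 < t) (h1 : t < 1) (n : ℕ) : ∀ {f g h : (Fin n → ℝ) → ℝ≥0∞},
    Measurable f → Measurable g → Measurable h →
    (∀ x y, f x ^ (1 - t) * g y ^ t ≤ h ((1 - t) • x + t • y)) →
    (∫⁻ x, f x) ^ (1 - t) * (∫⁻ x, g x) ^ t ≤ ∫⁻ x, h x := by
  induction n with
  | zero =>
    intro f g h hf hg hh H
    simp only [Measure.volume_pi_eq_dirac (0 : Fin 0 → ℝ), lintegral_dirac]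
    simpa using H 0 0
  | succ n ih =>
    intro f g h hf hg hh H
    let e := (MeasurableEquiv.piFinSuccAbove (fun _ : Fin (n+1) => ℝ) 0).symm
    have he : MeasurePreserving e volume volume :=
      (volume_preserving_piFinSuccAbove (fun _ : Fin (n+1) => ℝ) 0).symm
    have fub : ∀ u : (Fin (n+1) → ℝ) → ℝ≥0∞, Measurable u →
        ∫⁻ x, u x = ∫⁻ a : ℝ, ∫⁻ z : Fin n → ℝ, u (e (a, z)) := by
      intro u hu
      rw [← he.lintegral_comp hu, Measure.volume_eq_prod]
      exact lintegral_prod _ (hu.comp e.measurable).aemeasurable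
    have el : ∀ a b : ℝ, ∀ x y : Fin n → ℝ, (1 - t) • e (a, x) + t • e (b, y)
        = e ((1 - t) * a + t * b, (1 - t) • x + t • y) := by
      intro a b x y
      ext i
      refine Fin.cases ?_ (fun j => ?_) i <;>
        simp [e, MeasurableEquiv.piFinSuccAbove]
    have m : ∀ u : (Fin (n+1) → ℝ) → ℝ≥0∞, Measurable u → ∀ a, Measurable fun z => u (e (a, z)) :=
      fun u hu a => hu.comp (e.measurable.comp measurable_prodMk_left)
    rw [fub f hf, fub g hg, fub h hh]
    refine pl_one h0 h1 ((hf.comp e.measurable).lintegral_prod_right')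
      ((hg.comp e.measurable).lintegral_prod_right')
      ((hh.comp e.measurable).lintegral_prod_right') ?_
    intro a b
    refine ih (m f hf a) (m g hg b) (m h hh _) ?_
    intro x y
    have := H (e (a, x)) (e (b, y))
    rwa [el] at this

lemma pl_euc {t : ℝ} (h0 : 0 < t) (h1 : t < 1) {n : ℕ} {f g h : EuclideanSpace ℝ (Fin n) → ℝ≥0∞}
    (hf : Measurable f) (hg : Measurable g) (hh : Measurable h)
    (H : ∀ x y, f x ^ (1 - t) * g y ^ t ≤ h ((1 - t) • x + t • y)) :
    (∫⁻ x, f x) ^ (1 - t) * (∫⁻ x, g x) ^ t ≤ ∫⁻ x, h x := by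
  have he := PiLp.volume_preserving_toLp (Fin n)
  rw [← he.lintegral_comp hf, ← he.lintegral_comp hg, ← he.lintegral_comp hh]
  refine pl_pi h0 h1 n (hf.comp he.measurable) (hg.comp he.measurable) (hh.comp he.measurable) ?_
  intro x y
  exact H (WithLp.toLp 2 x) (WithLp.toLp 2 y)

lemma snd_deriv_nonneg {D : ℝ → ℝ} (hD : AnalyticAt ℝ D 0) (h0 : D 0 = 0) (hpos : ∀ e, 0 ≤ D e) :
    deriv D 0 = 0 ∧ 0 ≤ iteratedDeriv 2 D 0 := by
  have hmin : IsLocalMin D 0 := Eventually.of_forall fun e => by rw [h0]; exact hpos e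
  have hd := hmin.deriv_eq_zero
  refine ⟨hd, ?_⟩
  by_contra! hneg
  rw [iteratedDeriv_succ, iteratedDeriv_one] at hneg
  have hmax := isLocalMax_of_deriv_deriv_neg hneg hd hD.continuousAt
  have heq : D =ᶠ[𝓝 0] fun _ => 0 := by
    filter_upwards [hmax] with e he
    exact le_antisymm (h0 ▸ he) (hpos e)
  have := heq.deriv.deriv_eq
  simp at this
  linarith

lemma fst_deriv_nonneg {D : ℝ → ℝ} {d : ℝ} (hD : HasDerivAt D d 0) (h0 : D 0 = 0)
    (hpos : ∀ e, 0 ≤ e → 0 ≤ D e) : 0 ≤ d := by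
  have := hD.tendsto_slope_zero_right
  refine ge_of_tendsto this ?_
  filter_upwards [self_mem_nhdsWithin] with e he
  have he : 0 < e := he
  simp only [zero_add, h0, sub_zero, smul_eq_mul]
  exact mul_nonneg (by positivity) (hpos e he.le)

structure PLData {n : ℕ} (t : ℝ) (V : ℝ≥0∞) (K B M : Set (EuclideanSpace ℝ (Fin n))) : Prop where
  t0 : 0 < t
  t1 : t < 1
  V0 : V ≠ 0
  Vt : V ≠ ∞
  mK : MeasurableSet K
  mB : MeasurableSet B
  mM : MeasurableSet M
  bK : Bornology.IsBounded K
  bB : Bornology.IsBounded B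
  bM : Bornology.IsBounded M
  vK : volume K = V
  vB : volume B = V
  vM : volume M = V
  sub : ∀ x ∈ K, ∀ y ∈ B, (1 - t) • x + t • y ∈ M

open ProbabilityTheory in
lemma ies_univ {n : ℕ} {K : Set (EuclideanSpace ℝ (Fin n))} (bK : Bornology.IsBounded K)
    (mK : MeasurableSet K) {X : EuclideanSpace ℝ (Fin n) → ℝ} (hX : Continuous X) :
    integrableExpSet X (ProbabilityTheory.cond volume K) = univ := by
  have hc : IsCompact (closure K) := bK.isCompact_closure
  obtain ⟨C, hC⟩ := hc.exists_bound_of_continuousOn hX.continuousOn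
  rw [eq_univ_iff_forall]
  intro e
  refine integrable_exp_mul_of_mem_Icc (a := -C) (b := C) hX.measurable.aemeasurable ?_
  have : ∀ᵐ x ∂(ProbabilityTheory.cond volume K), x ∈ K := ae_cond_mem mK
  filter_upwards [this] with x hx
  exact abs_le.1 (hC x (subset_closure hx))

open ProbabilityTheory in
lemma lint_exp {n : ℕ} {K : Set (EuclideanSpace ℝ (Fin n))} (bK : Bornology.IsBounded K)
    (mK : MeasurableSet K) {X : EuclideanSpace ℝ (Fin n) → ℝ} (hX : Continuous X) (e : ℝ)
    (h0 : volume K ≠ 0) (ht : volume K ≠ ∞) :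
    ∫⁻ x, K.indicator (fun x => ENNReal.ofReal (Real.exp (e * X x))) x =
      volume K * ENNReal.ofReal (mgf X (ProbabilityTheory.cond volume K) e) := by
  have hi : Integrable (fun x => Real.exp (e * X x)) (ProbabilityTheory.cond volume K) := by
    have := ies_univ bK mK hX
    have h : e ∈ integrableExpSet X (ProbabilityTheory.cond volume K) := by rw [this]; trivial
    exact h
  rw [mgf, ofReal_integral_eq_lintegral_ofReal hi (Eventually.of_forall fun x => (Real.exp_pos _).le),
    ProbabilityTheory.cond, lintegral_smul_measure, lintegral_indicator mK, smul_eq_mul, ← mul_assoc,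
    ENNReal.mul_inv_cancel h0 ht, one_mul]

open ProbabilityTheory in
lemma PLData.prob {n : ℕ} {t : ℝ} {V : ℝ≥0∞} {K B M : Set (EuclideanSpace ℝ (Fin n))}
    (h : PLData t V K B M) : IsProbabilityMeasure (ProbabilityTheory.cond volume K) ∧
      IsProbabilityMeasure (ProbabilityTheory.cond volume B) ∧
      IsProbabilityMeasure (ProbabilityTheory.cond volume M) := by
  refine ⟨?_, ?_, ?_⟩
  · exact cond_isProbabilityMeasure_of_finite (by rw [h.vK]; exact h.V0) (by rw [h.vK]; exact h.Vt)
  · exact cond_isProbabilityMeasure_of_finite (by rw [h.vB]; exact h.V0) (by rw [h.vB]; exact h.Vt)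
  · exact cond_isProbabilityMeasure_of_finite (by rw [h.vM]; exact h.V0) (by rw [h.vM]; exact h.Vt)

open ProbabilityTheory in
lemma PLData.cgf_le {n : ℕ} {t : ℝ} {V : ℝ≥0∞} {K B M : Set (EuclideanSpace ℝ (Fin n))}
    (h : PLData t V K B M) {X Y Z : EuclideanSpace ℝ (Fin n) → ℝ} (hX : Continuous X)
    (hY : Continuous Y) (hZ : Continuous Z)
    (H : ∀ x ∈ K, ∀ y ∈ B, (1 - t) * X x + t * Y y ≤ Z ((1 - t) • x + t • y)) {e : ℝ} (he : 0 ≤ e) :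
    (1 - t) * cgf X (ProbabilityTheory.cond volume K) e + t * cgf Y (ProbabilityTheory.cond volume B) e
      ≤ cgf Z (ProbabilityTheory.cond volume M) e := by
  obtain ⟨_, _, _⟩ := h.prob
  have h0 := h.t0
  have h1 : 0 < 1 - t := by linarith [h.t1]
  have pos : ∀ (S : Set (EuclideanSpace ℝ (Fin n))) (W : EuclideanSpace ℝ (Fin n) → ℝ),
      Continuous W → Bornology.IsBounded S → MeasurableSet S →
      IsProbabilityMeasure (ProbabilityTheory.cond volume S) →
      0 < mgf W (ProbabilityTheory.cond volume S) e := by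
    intro S W hW bS mS _
    refine mgf_pos ?_
    have h : e ∈ integrableExpSet W (ProbabilityTheory.cond volume S) := by
      rw [ies_univ bS mS hW]; trivial
    exact h
  have pK := pos K X hX h.bK h.mK inferInstance
  have pB := pos B Y hY h.bB h.mB inferInstance
  have pM := pos M Z hZ h.bM h.mM inferInstance
  have me : ∀ W : EuclideanSpace ℝ (Fin n) → ℝ, Continuous W →
    Measurable fun x => ENNReal.ofReal (Real.exp (e * W x)) := by
    intro W hW
    have := hW.measurable
    fun_prop
  have key := pl_euc h.t0 h.t1 ((me X hX).indicator h.mK) ((me Y hY).indicator h.mB)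
    ((me Z hZ).indicator h.mM) (by
      intro x y
      by_cases hx : x ∈ K
      swap
      · simp [hx, h1]
      by_cases hy : y ∈ B
      swap
      · simp [hy, h0]
      rw [indicator_of_mem hx, indicator_of_mem hy, indicator_of_mem (h.sub x hx y hy),
        ENNReal.ofReal_rpow_of_pos (Real.exp_pos _), ENNReal.ofReal_rpow_of_pos (Real.exp_pos _),
        ← ENNReal.ofReal_mul (by positivity), ← Real.exp_mul, ← Real.exp_mul, ← Real.exp_add]
      apply ENNReal.ofReal_le_ofReal
      apply Real.exp_le_exp.2
      have := mul_le_mul_of_nonneg_left (H x hx y hy) he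
      linarith)
  rw [lint_exp h.bK h.mK hX e (by rw [h.vK]; exact h.V0) (by rw [h.vK]; exact h.Vt),
    lint_exp h.bB h.mB hY e (by rw [h.vB]; exact h.V0) (by rw [h.vB]; exact h.Vt),
    lint_exp h.bM h.mM hZ e (by rw [h.vM]; exact h.V0) (by rw [h.vM]; exact h.Vt),
    h.vK, h.vB, h.vM, ENNReal.mul_rpow_of_nonneg _ _ h1.le, ENNReal.mul_rpow_of_nonneg _ _ h0.le,
    mul_mul_mul_comm, ← ENNReal.rpow_add _ _ h.V0 h.Vt, sub_add_cancel, ENNReal.rpow_one,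
    ENNReal.mul_le_mul_iff_right h.V0 h.Vt, ENNReal.ofReal_rpow_of_pos pK,
    ENNReal.ofReal_rpow_of_pos pB, ← ENNReal.ofReal_mul (by positivity),
    ENNReal.ofReal_le_ofReal_iff pM.le] at key
  have := Real.log_le_log (by positivity) key
  rw [Real.log_mul (by positivity) (by positivity), Real.log_rpow pK, Real.log_rpow pB] at this
  exact this

open ProbabilityTheory in
lemma PLData.mean_le {n : ℕ} {t : ℝ} {V : ℝ≥0∞} {K B M : Set (EuclideanSpace ℝ (Fin n))}
    (h : PLData t V K B M) {X Y Z : EuclideanSpace ℝ (Fin n) → ℝ} (hX : Continuous X)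
    (hY : Continuous Y) (hZ : Continuous Z)
    (H : ∀ x ∈ K, ∀ y ∈ B, (1 - t) * X x + t * Y y ≤ Z ((1 - t) • x + t • y)) :
    (1 - t) * (∫ x, X x ∂(ProbabilityTheory.cond volume K))
      + t * (∫ x, Y x ∂(ProbabilityTheory.cond volume B))
      ≤ ∫ x, Z x ∂(ProbabilityTheory.cond volume M) := by
  obtain ⟨_, _, _⟩ := h.prob
  have hd : ∀ (S : Set (EuclideanSpace ℝ (Fin n))) (W : EuclideanSpace ℝ (Fin n) → ℝ),
      Continuous W → Bornology.IsBounded S → MeasurableSet S →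
      IsProbabilityMeasure (ProbabilityTheory.cond volume S) →
      HasDerivAt (cgf W (ProbabilityTheory.cond volume S))
        (∫ x, W x ∂(ProbabilityTheory.cond volume S)) 0 := by
    intro S W hW bS mS _
    have h0 : 0 ∈ interior (integrableExpSet W (ProbabilityTheory.cond volume S)) := by
      rw [ies_univ bS mS hW, interior_univ]; trivial
    have := (analyticAt_cgf h0).differentiableAt.hasDerivAt
    rw [deriv_cgf_zero h0] at this
    simpa using this
  have := fst_deriv_nonneg (((hd M Z hZ h.bM h.mM inferInstance).sub
    ((hd K X hX h.bK h.mK inferInstance).const_mul (1 - t))).sub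
    ((hd B Y hY h.bB h.mB inferInstance).const_mul t)) (by simp) (by
      intro e he
      have := h.cgf_le hX hY hZ H he
      simp only [Pi.sub_apply]
      linarith)
  linarith

open ProbabilityTheory in
lemma PLData.lin {n : ℕ} {t : ℝ} {V : ℝ≥0∞} {K B M : Set (EuclideanSpace ℝ (Fin n))}
    (h : PLData t V K B M) {X : EuclideanSpace ℝ (Fin n) → ℝ} (hX : Continuous X)
    (H : ∀ x y, (1 - t) * X x + t * X y = X ((1 - t) • x + t • y)) :
    (1 - t) * (∫ x, X x ∂(ProbabilityTheory.cond volume K))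
      + t * (∫ x, X x ∂(ProbabilityTheory.cond volume B))
      = ∫ x, X x ∂(ProbabilityTheory.cond volume M) ∧
    (1 - t) * (∫ x, (X x - ∫ y, X y ∂(ProbabilityTheory.cond volume K))^2
        ∂(ProbabilityTheory.cond volume K))
      + t * (∫ x, (X x - ∫ y, X y ∂(ProbabilityTheory.cond volume B))^2
        ∂(ProbabilityTheory.cond volume B))
      ≤ ∫ x, (X x - ∫ y, X y ∂(ProbabilityTheory.cond volume M))^2
        ∂(ProbabilityTheory.cond volume M) := by
  obtain ⟨_, _, _⟩ := h.prob
  have hd : ∀ (S : Set (EuclideanSpace ℝ (Fin n))) (W : EuclideanSpace ℝ (Fin n) → ℝ),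
      Continuous W → Bornology.IsBounded S → MeasurableSet S →
      IsProbabilityMeasure (ProbabilityTheory.cond volume S) →
      AnalyticAt ℝ (cgf W (ProbabilityTheory.cond volume S)) 0 ∧
      deriv (cgf W (ProbabilityTheory.cond volume S)) 0 =
        (∫ x, W x ∂(ProbabilityTheory.cond volume S)) ∧
      iteratedDeriv 2 (cgf W (ProbabilityTheory.cond volume S)) 0 =
        ∫ x, (W x - ∫ y, W y ∂(ProbabilityTheory.cond volume S))^2
        ∂(ProbabilityTheory.cond volume S) := by
    intro S W hW bS mS _
    have h0 : 0 ∈ interior (integrableExpSet W (ProbabilityTheory.cond volume S)) := by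
      rw [ies_univ bS mS hW, interior_univ]; trivial
    have e1 : deriv (cgf W (ProbabilityTheory.cond volume S)) 0 =
        (∫ x, W x ∂(ProbabilityTheory.cond volume S)) := by
      rw [deriv_cgf_zero h0]; simp
    refine ⟨analyticAt_cgf h0, e1, ?_⟩
    rw [iteratedDeriv_two_cgf_eq_integral h0, e1]
    simp
  obtain ⟨aM, dM, iM⟩ := hd M X hX h.bM h.mM inferInstance
  obtain ⟨aK, dK, iK⟩ := hd K X hX h.bK h.mK inferInstance
  obtain ⟨aB, dB, iB⟩ := hd B X hX h.bB h.mB inferInstance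
  have aK' := aK.fun_const_smul (c := 1 - t)
  have aB' := aB.fun_const_smul (c := t)
  have key := snd_deriv_nonneg ((aM.sub aK').sub aB') (by simp) (by
    intro e
    simp only [Pi.sub_apply, smul_eq_mul]
    rcases le_total 0 e with he | he
    · have := h.cgf_le hX hX hX (fun x _ y _ => (H x y).le) he
      linarith
    · have := h.cgf_le hX.neg hX.neg hX.neg (fun x _ y _ => by
        have := H x y
        simp only [Pi.neg_apply]
        linarith) (neg_nonneg.2 he)
      simp only [cgf_neg, neg_neg] at this
      linarith)
  obtain ⟨k1, k2⟩ := key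
  have cd : ∀ {u : ℝ → ℝ}, AnalyticAt ℝ u 0 → ContDiffAt ℝ (2 : ℕ) u 0 :=
    fun hu => hu.contDiffAt
  rw [deriv_sub (aM.sub aK').differentiableAt aB'.differentiableAt,
    deriv_sub aM.differentiableAt aK'.differentiableAt, deriv_fun_const_smul _ aK.differentiableAt,
    deriv_fun_const_smul _ aB.differentiableAt, dM, dK, dB] at k1
  rw [iteratedDeriv_sub (cd (aM.sub aK')) (cd aB'), iteratedDeriv_sub (cd aM) (cd aK'),
    iteratedDeriv_fun_const_smul_field, iteratedDeriv_fun_const_smul_field, iM, iK, iB] at k2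
  simp only [smul_eq_mul] at k1 k2
  constructor <;> linarith

lemma integ_cond {n : ℕ} {K : Set (EuclideanSpace ℝ (Fin n))} (bK : Bornology.IsBounded K)
    (mK : MeasurableSet K) {X : EuclideanSpace ℝ (Fin n) → ℝ} (hX : Continuous X) :
    Integrable X (ProbabilityTheory.cond volume K) := by
  have hc : IsCompact (closure K) := bK.isCompact_closure
  obtain ⟨C, hC⟩ := hc.exists_bound_of_continuousOn hX.continuousOn
  refine Integrable.of_bound hX.aestronglyMeasurable C ?_
  have : ∀ᵐ x ∂(ProbabilityTheory.cond volume K), x ∈ K := ProbabilityTheory.ae_cond_mem mK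
  filter_upwards [this] with x hx
  exact hC x (subset_closure hx)

lemma integ_on {n : ℕ} {K : Set (EuclideanSpace ℝ (Fin n))} (bK : Bornology.IsBounded K)
    {X : EuclideanSpace ℝ (Fin n) → ℝ} (hX : Continuous X) :
    IntegrableOn X K volume :=
  (hX.continuousOn.integrableOn_compact bK.isCompact_closure).mono_set subset_closure

/-- coordinatewise mean -/
def cmean {n : ℕ} (K : Set (EuclideanSpace ℝ (Fin n))) : EuclideanSpace ℝ (Fin n) :=
  WithLp.toLp 2 fun i => ∫ x, x i ∂(ProbabilityTheory.cond volume K)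

lemma nsq_sum {n : ℕ} {K : Set (EuclideanSpace ℝ (Fin n))} (bK : Bornology.IsBounded K)
    (mK : MeasurableSet K) (c : EuclideanSpace ℝ (Fin n)) :
    ∫ x, ‖x - c‖ ^ 2 ∂(ProbabilityTheory.cond volume K) =
      ∑ i, ∫ x, (x i - c i) ^ 2 ∂(ProbabilityTheory.cond volume K) := by
  rw [← integral_finsetSum]
  · simp [EuclideanSpace.norm_sq_eq]
  · intro i _
    exact integ_cond bK mK (by fun_prop)

lemma norm_comb {n : ℕ} (u w : EuclideanSpace ℝ (Fin n)) {a b t : ℝ} (ha : 0 < a) (hb : 0 < b)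
    (h0 : 0 < t) (h1 : t < 1) :
    a * b / ((1 - t) * b + t * a) * ‖(1 - t) • u + t • w‖ ^ 2 ≤
      (1 - t) * (a * ‖u‖ ^ 2) + t * (b * ‖w‖ ^ 2) := by
  have h1' : 0 < 1 - t := by linarith
  have hD : 0 < (1 - t) * b + t * a := by positivity
  have h := norm_add_le ((1 - t) • u) (t • w)
  rw [norm_smul, norm_smul, Real.norm_of_nonneg h1'.le, Real.norm_of_nonneg h0.le] at h
  have h2 : ‖(1 - t) • u + t • w‖ ^ 2 ≤ ((1 - t) * ‖u‖ + t * ‖w‖) ^ 2 := by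
    gcongr
  have h3 : a * b * ((1 - t) * ‖u‖ + t * ‖w‖) ^ 2 ≤
      ((1 - t) * (a * ‖u‖ ^ 2) + t * (b * ‖w‖ ^ 2)) * ((1 - t) * b + t * a) := by
    have : 0 ≤ t * (1 - t) * (a * ‖u‖ - b * ‖w‖) ^ 2 := by positivity
    nlinarith [this]
  rw [div_mul_eq_mul_div, div_le_iff₀ hD]
  exact (mul_le_mul_of_nonneg_left h2 (by positivity)).trans h3

lemma PLData.var_le {n : ℕ} {t : ℝ} {V : ℝ≥0∞} {K B M : Set (EuclideanSpace ℝ (Fin n))}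
    (h : PLData t V K B M) :
    ∫ x, ‖x - cmean K‖ ^ 2 ∂(ProbabilityTheory.cond volume K) ≤
      ∫ x, ‖x‖ ^ 2 ∂(ProbabilityTheory.cond volume B) := by
  obtain ⟨_, _, _⟩ := h.prob
  have t0 := h.t0
  have t1 : 0 < 1 - t := by linarith [h.t1]
  have hlin := fun i : Fin n => h.lin (X := fun x => x i) (by fun_prop) (by intro x y; simp)
  have hc : cmean M = (1 - t) • cmean K + t • cmean B := by
    ext i
    simp [cmean, (hlin i).1]
  have hB : ∫ x, ‖x - cmean B‖ ^ 2 ∂(ProbabilityTheory.cond volume B) ≤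
      ∫ x, ‖x‖ ^ 2 ∂(ProbabilityTheory.cond volume B) := by
    have := nsq_sum h.bB h.mB 0
    simp only [sub_zero] at this
    rw [this, nsq_sum h.bB h.mB]
    refine Finset.sum_le_sum fun i _ => ?_
    have hm : AEMeasurable (fun x : EuclideanSpace ℝ (Fin n) => x i)
      (ProbabilityTheory.cond volume B) := by fun_prop
    have := ProbabilityTheory.variance_le_expectation_sq hm.aestronglyMeasurable
    rw [ProbabilityTheory.variance_eq_integral hm] at this
    simpa [cmean] using this
  have hsum : (1 - t) * ∫ x, ‖x - cmean K‖ ^ 2 ∂(ProbabilityTheory.cond volume K)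
      + t * ∫ x, ‖x - cmean B‖ ^ 2 ∂(ProbabilityTheory.cond volume B)
      ≤ ∫ x, ‖x - cmean M‖ ^ 2 ∂(ProbabilityTheory.cond volume M) := by
    rw [nsq_sum h.bB h.mB, nsq_sum h.bK h.mK, nsq_sum h.bM h.mM, Finset.mul_sum, Finset.mul_sum,
      ← Finset.sum_add_distrib]
    exact Finset.sum_le_sum fun i _ => (hlin i).2
  refine le_trans ?_ hB
  set A := ∫ x, ‖x - cmean K‖ ^ 2 ∂(ProbabilityTheory.cond volume K) with hA
  set C := ∫ x, ‖x - cmean B‖ ^ 2 ∂(ProbabilityTheory.cond volume B) with hC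
  set D := ∫ x, ‖x - cmean M‖ ^ 2 ∂(ProbabilityTheory.cond volume M) with hD
  by_contra! hlt
  have hC0 : 0 ≤ C := integral_nonneg fun x => by positivity
  have hA0 : 0 < A := hC0.trans_lt hlt
  have ha : 0 < A + C := by linarith
  have hb : 0 < 2 * A := by linarith
  have key := h.mean_le (X := fun x => -((A + C) * ‖x - cmean K‖ ^ 2))
    (Y := fun x => -((2 * A) * ‖x - cmean B‖ ^ 2))
    (Z := fun x => -((A + C) * (2 * A) / ((1 - t) * (2 * A) + t * (A + C)) * ‖x - cmean M‖ ^ 2))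
    (by fun_prop) (by fun_prop) (by fun_prop) (by
      intro x _ y _
      have := norm_comb (x - cmean K) (y - cmean B) ha hb t0 h.t1
      rw [hc, show (1 - t) • x + t • y - ((1 - t) • cmean K + t • cmean B)
        = (1 - t) • (x - cmean K) + t • (y - cmean B) by module]
      linarith)
  rw [integral_neg, integral_neg, integral_neg, integral_const_mul, integral_const_mul,
    integral_const_mul, ← hA, ← hC, ← hD] at key
  have hDD : 0 < (1 - t) * (2 * A) + t * (A + C) := by positivity
  have key2 : (A + C) * (2 * A) / ((1 - t) * (2 * A) + t * (A + C)) * D ≤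
    (1 - t) * ((A + C) * A) + t * (2 * A * C) := by linarith
  rw [div_mul_eq_mul_div, div_le_iff₀ hDD] at key2
  have k3 := mul_le_mul_of_nonneg_left hsum (mul_pos ha hb).le
  have k4 : 0 < t * (1 - t) * (A - C) * (A * (A - C)) := by
    have : 0 < A - C := by linarith
    positivity
  nlinarith [k3, k4, key2]

lemma bathtub {n : ℕ} {K : Set (EuclideanSpace ℝ (Fin n))} (bK : Bornology.IsBounded K)
    (mK : MeasurableSet K) {R : ℝ} (hR : 0 < R) (p : EuclideanSpace ℝ (Fin n))
    (hv : volume K = volume (ball (0 : EuclideanSpace ℝ (Fin n)) R))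
    (hle : ∫ x, ‖x - p‖ ^ 2 ∂(ProbabilityTheory.cond volume K) ≤
      ∫ x, ‖x‖ ^ 2 ∂(ProbabilityTheory.cond volume (ball (0 : EuclideanSpace ℝ (Fin n)) R))) :
    volume ((K \ ball p R) ∪ (ball p R \ K)) = 0 := by
  have bfin : volume (ball p R) ≠ ∞ := measure_ball_lt_top.ne
  have hv' : volume (ball p R) = volume (ball (0 : EuclideanSpace ℝ (Fin n)) R) :=
    Measure.addHaar_ball_center _ _ _
  have hvpos : 0 < (volume (ball (0 : EuclideanSpace ℝ (Fin n)) R)).toReal :=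
    ENNReal.toReal_pos (measure_ball_pos _ _ hR).ne' measure_ball_lt_top.ne
  have hle2 : ∫ x in K, ‖x - p‖ ^ 2 ≤ ∫ x in ball p R, ‖x - p‖ ^ 2 := by
    have e : ∫ x in ball p R, ‖x - p‖ ^ 2 = ∫ x in ball (0 : EuclideanSpace ℝ (Fin n)) R, ‖x‖ ^ 2 := by
      have mp : MeasurePreserving (fun x : EuclideanSpace ℝ (Fin n) => x - p) volume volume :=
        measurePreserving_sub_right volume p
      have := mp.setIntegral_preimage_emb (MeasurableEquiv.subRight p).measurableEmbedding
        (fun x => ‖x‖ ^ 2) (ball 0 R)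
      rw [← this]
      congr 2
      ext x
      simp [dist_eq_norm]
    rw [e]
    simp only [ProbabilityTheory.cond, integral_smul_measure, hv, smul_eq_mul] at hle
    exact le_of_mul_le_mul_left hle (by rw [ENNReal.toReal_inv]; positivity)
  set g : EuclideanSpace ℝ (Fin n) → ℝ := fun x => ‖x - p‖ ^ 2 - R ^ 2 with hg
  have gc : Continuous g := by fun_prop
  have bB : Bornology.IsBounded (ball p R) := isBounded_ball
  have hle3 : ∫ x in K, g x ≤ ∫ x in ball p R, g x := by
    rw [hg, integral_sub (integ_on bK (by fun_prop)) (integ_on bK (by fun_prop)),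
      integral_sub (integ_on bB (by fun_prop)) (integ_on bB (by fun_prop))]
    simp only [setIntegral_const, Measure.real, hv, hv']
    linarith
  have s1 := integral_inter_add_sdiff (μ := volume) (f := g) (s := K) (t := ball p R)
    measurableSet_ball (integ_on bK gc)
  have s2 := integral_inter_add_sdiff (μ := volume) (f := g) (s := ball p R) (t := K)
    mK (integ_on bB gc)
  rw [inter_comm] at s2
  have p1 : 0 ≤ ∫ x in K \ ball p R, g x := by
    refine setIntegral_nonneg (mK.diff measurableSet_ball) fun x hx => ?_
    have : R ≤ ‖x - p‖ := by simpa [dist_eq_norm] using hx.2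
    simp only [hg]; nlinarith
  have p2 : ∫ x in ball p R \ K, -g x ≤ 0 := by
    rw [integral_neg]; linarith
  have gneg : ∀ x ∈ ball p R \ K, 0 < - g x := by
    intro x hx
    have : ‖x - p‖ < R := by simpa [dist_eq_norm] using hx.1
    simp only [hg]; nlinarith [norm_nonneg (x - p)]
  have z : volume (ball p R \ K) = 0 := by
    by_contra hne
    have := (setIntegral_pos_iff_support_of_nonneg_ae (μ := volume) (s := ball p R \ K)
      (f := fun x => - g x) ((ae_restrict_iff' (measurableSet_ball.diff mK)).2
        (Eventually.of_forall fun x hx => (gneg x hx).le))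
      (integ_on (bB.subset sdiff_subset) gc.neg)).2 (by
        refine (pos_iff_ne_zero.2 hne).trans_le (measure_mono fun x hx => ⟨(gneg x hx).ne', hx⟩))
    linarith
  have z2 : volume (K \ ball p R) = 0 := by
    have e1 := measure_inter_add_sdiff (μ := volume) K (measurableSet_ball (x := p) (ε := R))
    have e2 := measure_inter_add_sdiff (μ := volume) (ball p R) mK
    rw [z, add_zero, inter_comm] at e2
    rw [e2, hv, hv'] at e1
    have hf : volume (ball (0 : EuclideanSpace ℝ (Fin n)) R) ≠ ∞ := measure_ball_lt_top.ne
    exact (ENNReal.add_right_inj hf).1 (by rw [e1, add_zero])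
  exact measure_union_null z2 z

lemma bm_comb {n : ℕ} {A : Set (EuclideanSpace ℝ (Fin n))} {R r : ℝ} (hR : 0 < R) (hr : 0 < r) :
    ∀ x ∈ A, ∀ y ∈ ball (0 : EuclideanSpace ℝ (Fin n)) R,
      (1 - r / (R + r)) • x + (r / (R + r)) • y ∈
        (fun z : EuclideanSpace ℝ (Fin n) => ((R + r) / R) • z) ⁻¹' (thickening r A) := by
  intro x hx y hy
  rw [mem_preimage, mem_thickening_iff]
  refine ⟨x, hx, ?_⟩
  have hRr : 0 < R + r := by linarith
  have : ((R + r) / R) • ((1 - r / (R + r)) • x + (r / (R + r)) • y) = x + (r / R) • y := by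
    rw [smul_add, smul_smul, smul_smul]
    congr 1
    · rw [show (R + r) / R * (1 - r / (R + r)) = 1 by field_simp; ring, one_smul]
    · congr 1; field_simp
  rw [this, dist_eq_norm, add_sub_cancel_left, norm_smul, Real.norm_of_nonneg (by positivity)]
  have hy' : ‖y‖ < R := by simpa using hy
  rw [div_mul_eq_mul_div, div_lt_iff₀ hR]
  exact mul_lt_mul_of_pos_left hy' hr

lemma ball_pre {n : ℕ} {R r : ℝ} (hR : 0 < R) (hr : 0 < r) :
    (fun z : EuclideanSpace ℝ (Fin n) => ((R + r) / R) • z) ⁻¹' (ball 0 (R + r)) = ball 0 R := by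
  ext z
  have hRr : 0 < R + r := by linarith
  simp only [mem_preimage, mem_ball_zero_iff, norm_smul]
  rw [Real.norm_of_nonneg (by positivity), div_mul_eq_mul_div, div_lt_iff₀ hR,
    mul_lt_mul_iff_right₀ hRr]

lemma pre_vol {n : ℕ} {R r : ℝ} (hR : 0 < R) (hr : 0 < r) :
    ∃ c : ℝ≥0∞, c ≠ 0 ∧ c ≠ ∞ ∧ ∀ S : Set (EuclideanSpace ℝ (Fin n)),
      volume ((fun z : EuclideanSpace ℝ (Fin n) => ((R + r) / R) • z) ⁻¹' S) = c * volume S := by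
  have h : (R + r) / R ≠ 0 := by positivity
  refine ⟨_, ?_, ?_, fun S => Measure.addHaar_preimage_smul volume h S⟩
  · simp only [ne_eq, ENNReal.ofReal_eq_zero, not_le]; positivity
  · simp

lemma bm_ball {n : ℕ} {A : Set (EuclideanSpace ℝ (Fin n))} (mA : MeasurableSet A) {R r : ℝ}
    (hR : 0 < R) (hr : 0 < r)
    (hv : volume A = volume (ball (0 : EuclideanSpace ℝ (Fin n)) R)) :
    volume (ball (0 : EuclideanSpace ℝ (Fin n)) (R + r)) ≤ volume (thickening r A) := by
  obtain ⟨c, c0, ct, hc⟩ := pre_vol (n := n) hR hr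
  have hRr : 0 < R + r := by linarith
  have h0 : 0 < r / (R + r) := by positivity
  have h1 : r / (R + r) < 1 := by rw [div_lt_one hRr]; linarith
  have h1' : 0 < 1 - r / (R + r) := by linarith
  rw [← ENNReal.mul_le_mul_iff_right c0 ct, ← hc, ← hc, ball_pre hR hr]
  set M := (fun z : EuclideanSpace ℝ (Fin n) => ((R + r) / R) • z) ⁻¹' (thickening r A)
  have mM : MeasurableSet M := (isOpen_thickening.preimage (by fun_prop)).measurableSet
  have key := pl_euc h0 h1 (f := A.indicator 1) (g := (ball 0 R).indicator 1) (h := M.indicator 1)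
    (measurable_one.indicator mA) (measurable_one.indicator measurableSet_ball)
    (measurable_one.indicator mM) (by
      intro x y
      by_cases hx : x ∈ A
      swap
      · simp [hx, h1']
      by_cases hy : y ∈ ball (0 : EuclideanSpace ℝ (Fin n)) R
      swap
      · rw [indicator_of_notMem hy]; simp [h0]
      rw [indicator_of_mem hx, indicator_of_mem hy, indicator_of_mem (bm_comb hR hr x hx y hy)]
      simp)
  rw [lintegral_indicator_one mA, lintegral_indicator_one measurableSet_ball,
    lintegral_indicator_one mM, hv, ← ENNReal.rpow_add _ _ (measure_ball_pos _ _ hR).ne'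
    measure_ball_lt_top.ne] at key
  simpa using key

lemma bdd_of_thick {n : ℕ} {A : Set (EuclideanSpace ℝ (Fin n))} {r : ℝ} (hr : 0 < r)
    (hf : volume (thickening r A) ≠ ∞) : Bornology.IsBounded A := by
  have ht : Tendsto (fun m : ℕ => volume (thickening r A \ ball (0 : EuclideanSpace ℝ (Fin n)) m))
      atTop (𝓝 0) := by
    have := tendsto_measure_iInter_atTop (μ := volume)
      (s := fun m : ℕ => thickening r A \ ball (0 : EuclideanSpace ℝ (Fin n)) m)
      (fun m => (isOpen_thickening.measurableSet.diff measurableSet_ball).nullMeasurableSet)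
      (fun m k hmk => sdiff_subset_sdiff_right (ball_subset_ball (by exact_mod_cast hmk)))
      ⟨0, ne_top_of_le_ne_top hf (measure_mono sdiff_subset)⟩
    have e : (⋂ m : ℕ, thickening r A \ ball (0 : EuclideanSpace ℝ (Fin n)) m) = ∅ := by
      ext x
      simp only [mem_iInter, mem_empty_iff_false, iff_false, not_forall]
      obtain ⟨m, hm⟩ := exists_nat_gt ‖x‖
      exact ⟨m, fun h => h.2 (by simpa using hm)⟩
    rwa [e, measure_empty] at this
  obtain ⟨m, hm⟩ := (ht.eventually (gt_mem_nhds (measure_ball_pos volume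
    (0 : EuclideanSpace ℝ (Fin n)) hr))).exists
  refine (isBounded_ball (x := (0 : EuclideanSpace ℝ (Fin n))) (r := m + r)).subset ?_
  intro x hx
  by_contra hxm
  have hxm : m + r ≤ ‖x‖ := by simpa using hxm
  rw [← Measure.addHaar_ball_center volume x] at hm
  refine absurd hm (not_lt.2 (measure_mono fun y hy => ⟨ball_subset_thickening hx r hy, ?_⟩))
  have hy : ‖y - x‖ < r := by simpa [dist_eq_norm] using hy
  simp only [mem_ball_zero_iff, not_lt]
  have := norm_sub_norm_le x y
  rw [norm_sub_rev] at this
  linarith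

lemma rigid {n : ℕ} {K : Set (EuclideanSpace ℝ (Fin n))} (mK : MeasurableSet K) {R r : ℝ}
    (hR : 0 < R) (hr : 0 < r)
    (hv : volume K = volume (ball (0 : EuclideanSpace ℝ (Fin n)) R))
    (hle : volume (thickening r K) ≤ volume (ball (0 : EuclideanSpace ℝ (Fin n)) (R + r))) :
    ∃ p : EuclideanSpace ℝ (Fin n), volume ((K \ ball p R) ∪ (ball p R \ K)) = 0 := by
  have hRr : 0 < R + r := by linarith
  have hfin : volume (thickening r K) ≠ ∞ := ne_top_of_le_ne_top measure_ball_lt_top.ne hle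
  have bK := bdd_of_thick hr hfin
  obtain ⟨c, c0, ct, hc⟩ := pre_vol (n := n) hR hr
  have hM : volume ((fun z : EuclideanSpace ℝ (Fin n) => ((R + r) / R) • z) ⁻¹' (thickening r K)) =
      volume (ball (0 : EuclideanSpace ℝ (Fin n)) R) := by
    rw [← ball_pre hR hr, hc, hc, le_antisymm hle (bm_ball mK hR hr hv)]
  have bM : Bornology.IsBounded
      ((fun z : EuclideanSpace ℝ (Fin n) => ((R + r) / R) • z) ⁻¹' (thickening r K)) := by
    obtain ⟨C, hC⟩ := (bK.thickening (δ := r)).exists_norm_le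
    refine isBounded_iff_forall_norm_le.2 ⟨C, fun z hz => ?_⟩
    have := hC _ hz
    rw [norm_smul, Real.norm_of_nonneg (by positivity)] at this
    have h1 : 1 ≤ (R + r) / R := by rw [one_le_div hR]; linarith
    nlinarith [norm_nonneg z]
  have h : PLData (r / (R + r)) (volume (ball (0 : EuclideanSpace ℝ (Fin n)) R)) K (ball 0 R)
      ((fun z : EuclideanSpace ℝ (Fin n) => ((R + r) / R) • z) ⁻¹' (thickening r K)) :=
    { t0 := by positivity
      t1 := by rw [div_lt_one hRr]; linarith
      V0 := (measure_ball_pos _ _ hR).ne'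
      Vt := measure_ball_lt_top.ne
      mK := mK
      mB := measurableSet_ball
      mM := (isOpen_thickening.preimage (by fun_prop)).measurableSet
      bK := bK
      bB := isBounded_ball
      bM := bM
      vK := hv
      vB := rfl
      vM := hM
      sub := bm_comb hR hr }
  exact ⟨cmean K, bathtub bK mK hR _ hv h.var_le⟩

lemma density_ae {n : ℕ} (hn : 1 ≤ n) {E : Set (EuclideanSpace ℝ (Fin n))} (hE : MeasurableSet E) :
    densityOnePoints n E =ᵐ[volume] E := by
  have : Nonempty (Fin n) := ⟨⟨0, hn⟩⟩
  have hb : ∀ (x : EuclideanSpace ℝ (Fin n)) (ρ : ℝ),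
      (ball x ρ : Set (EuclideanSpace ℝ (Fin n))) =ᵐ[volume] closedBall x ρ := by
    intro x ρ
    rw [← ball_union_sphere]
    exact (union_ae_eq_left_of_ae_eq_empty (ae_eq_empty.2 (Measure.addHaar_sphere volume x ρ))).symm
  filter_upwards [Besicovitch.ae_tendsto_measure_inter_div_of_measurableSet volume hE] with x hx
  have hx' : Tendsto (fun ρ : ℝ => volume (E ∩ ball x ρ) / volume (ball x ρ)) (𝓝[>] 0)
      (𝓝 (E.indicator 1 x)) := by
    refine hx.congr fun ρ => ?_
    rw [measure_congr (hb x ρ), measure_congr ((ae_eq_refl E).inter (hb x ρ))]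
  apply propext
  change Tendsto _ _ _ ↔ x ∈ E
  constructor
  · intro h
    by_contra hne
    rw [indicator_of_notMem hne] at hx'
    exact zero_ne_one (tendsto_nhds_unique hx' h)
  · intro h
    rw [indicator_of_mem h] at hx'
    exact hx'

lemma ball_frontier {n : ℕ} {R : ℝ} :
    frontier (densityOnePoints n (ball (0 : EuclideanSpace ℝ (Fin n)) R)) ⊆
      sphere (0 : EuclideanSpace ℝ (Fin n)) R := by
  have h1 : ball (0 : EuclideanSpace ℝ (Fin n)) R ⊆
      densityOnePoints n (ball (0 : EuclideanSpace ℝ (Fin n)) R) := by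
    intro x hx
    obtain ⟨ε, hε, hs⟩ := Metric.isOpen_iff.1 isOpen_ball x hx
    refine tendsto_const_nhds.congr' ?_
    filter_upwards [Ioo_mem_nhdsGT hε] with ρ hρ
    rw [inter_eq_right.2 ((ball_subset_ball hρ.2.le).trans hs), ENNReal.div_self
      (measure_ball_pos _ _ hρ.1).ne' measure_ball_lt_top.ne]
  have h2 : densityOnePoints n (ball (0 : EuclideanSpace ℝ (Fin n)) R) ⊆
      closedBall (0 : EuclideanSpace ℝ (Fin n)) R := by
    intro x hx
    by_contra hne
    obtain ⟨ε, hε, hs⟩ := Metric.isOpen_iff.1 (isClosed_closedBall.isOpen_compl) x hne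
    have : Tendsto (fun ρ : ℝ => volume (ball (0 : EuclideanSpace ℝ (Fin n)) R ∩ ball x ρ) /
        volume (ball x ρ)) (𝓝[>] 0) (𝓝 0) := by
      refine tendsto_const_nhds.congr' ?_
      filter_upwards [Ioo_mem_nhdsGT hε] with ρ hρ
      have : ball (0 : EuclideanSpace ℝ (Fin n)) R ∩ ball x ρ = ∅ := by
        ext y
        simp only [mem_inter_iff, mem_empty_iff_false, iff_false, not_and]
        intro hy hy'
        exact hs (ball_subset_ball hρ.2.le hy') (ball_subset_closedBall hy)
      simp [this]
    exact zero_ne_one (tendsto_nhds_unique this hx)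
  intro y hy
  have a := closure_minimal h2 isClosed_closedBall hy.1
  have b : y ∉ ball (0 : EuclideanSpace ℝ (Fin n)) R := fun hb =>
    hy.2 (interior_maximal h1 isOpen_ball hb)
  simp only [mem_closedBall_zero_iff, mem_ball_zero_iff, mem_sphere_zero_iff_norm] at *
  linarith

lemma exists_radius {n : ℕ} (hn : 1 ≤ n) {v : ℝ≥0∞} (h0 : v ≠ 0) (ht : v ≠ ∞) :
    ∃ ρ : ℝ, 0 < ρ ∧ v = volume (ball (0 : EuclideanSpace ℝ (Fin n)) ρ) := by
  have : Nonempty (Fin n) := ⟨⟨0, hn⟩⟩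
  set w := volume (ball (0 : EuclideanSpace ℝ (Fin n)) 1) with hw
  have w0 : w ≠ 0 := (measure_ball_pos _ _ one_pos).ne'
  have wt : w ≠ ∞ := measure_ball_lt_top.ne
  have hpos : 0 < v.toReal / w.toReal :=
    div_pos (ENNReal.toReal_pos h0 ht) (ENNReal.toReal_pos w0 wt)
  refine ⟨(v.toReal / w.toReal) ^ ((n : ℝ)⁻¹), Real.rpow_pos_of_pos hpos _, ?_⟩
  rw [Measure.addHaar_ball volume _ (Real.rpow_nonneg hpos.le _), finrank_euclideanSpace_fin,
    Real.rpow_inv_natCast_pow hpos.le (by omega), ENNReal.ofReal_div_of_pos (ENNReal.toReal_pos w0 wt),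
    ENNReal.ofReal_toReal ht, ENNReal.ofReal_toReal wt, ← hw, ENNReal.div_mul_cancel w0 wt]

lemma ball_mono_lt {n : ℕ} (hn : 1 ≤ n) {a b : ℝ} (ha : 0 ≤ a) (hb : 0 < b)
    (h : volume (ball (0 : EuclideanSpace ℝ (Fin n)) b) ≤ volume (ball (0 : EuclideanSpace ℝ (Fin n)) a)) :
    b ≤ a := by
  have : Nonempty (Fin n) := ⟨⟨0, hn⟩⟩
  rw [Measure.addHaar_ball volume _ ha, Measure.addHaar_ball volume _ hb.le,
    ENNReal.mul_le_mul_iff_left (measure_ball_pos _ _ one_pos).ne' measure_ball_lt_top.ne,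
    ENNReal.ofReal_le_ofReal_iff (by positivity), finrank_euclideanSpace_fin] at h
  exact le_of_pow_le_pow_left₀ (by omega) ha h

/-- Rigidity in the isoperimetric inequality: if `E` has the same volume as `B_R` and
`Per_r(E) = Per_r(B_R)`, then `E` agrees with some ball `B_R(p)` up to a null set. -/
theorem isoperimetric_rigidity (n : ℕ) (hn : 1 ≤ n) (R : ℝ) (hR : 0 < R) (r : ℝ) (hr : 0 < r)
    (E : Set (EuclideanSpace ℝ (Fin n))) (hE : MeasurableSet E)
    (hvol : volume E = volume (ball (0 : EuclideanSpace ℝ (Fin n)) R))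
    (hper : perR n r E Set.univ = perR n r (ball (0 : EuclideanSpace ℝ (Fin n)) R) Set.univ) :
    ∃ p : EuclideanSpace ℝ (Fin n),
      volume ((E \ ball p R) ∪ (ball p R \ E)) = 0 := by
  set D := densityOnePoints n E with hD
  have hDE : D =ᵐ[volume] E := density_ae hn hE
  have hDv : volume D = volume (ball (0 : EuclideanSpace ℝ (Fin n)) R) := by
    rw [measure_congr hDE, hvol]
  have hN : volume (thickening r (frontier D)) = volume (thickening r (frontier
      (densityOnePoints n (ball (0 : EuclideanSpace ℝ (Fin n)) R)))) := by
    simp only [perR, inter_univ] at hper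
    have h0 : ENNReal.ofReal (2 * r) ≠ 0 := by simpa using hr
    have := congrArg (· * ENNReal.ofReal (2 * r)) hper
    simpa only [ENNReal.div_mul_cancel h0 ENNReal.ofReal_ne_top] using this
  have hcb : closedBall (0 : EuclideanSpace ℝ (Fin n)) (R - r) ⊆ ball 0 (R + r) :=
    closedBall_subset_ball (by linarith)
  have hN2 : volume (thickening r (frontier D)) ≤ volume (ball (0 : EuclideanSpace ℝ (Fin n)) (R + r))
      - volume (closedBall (0 : EuclideanSpace ℝ (Fin n)) (R - r)) := by
    rw [hN, ← measure_sdiff hcb measurableSet_closedBall.nullMeasurableSet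
      measure_closedBall_lt_top.ne]
    refine measure_mono fun x hx => ?_
    obtain ⟨y, hy, hxy⟩ := mem_thickening_iff.1 hx
    have hy : ‖y‖ = R := by simpa using ball_frontier hy
    rw [dist_eq_norm] at hxy
    have h1 := norm_sub_norm_le x y
    have h2 := norm_sub_norm_le y x
    rw [norm_sub_rev] at h2
    simp only [Set.mem_sdiff, mem_ball_zero_iff, mem_closedBall_zero_iff, not_le]
    constructor <;> linarith
  set Dm : Set (EuclideanSpace ℝ (Fin n)) := (thickening r Dᶜ)ᶜ with hDm
  have mDm : MeasurableSet Dm := isOpen_thickening.measurableSet.compl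
  have hDmb : ∀ x, x ∈ Dm ↔ ball x r ⊆ D := by
    intro x
    rw [hDm, mem_compl_iff, mem_thickening_iff]
    push Not
    constructor
    · intro h y hy
      by_contra hne
      exact absurd (h y hne) (not_le.2 (by rwa [dist_comm]))
    · intro h y hy
      by_contra! hlt
      exact hy (h (by rwa [mem_ball, dist_comm]))
  have hDmD : thickening r Dm ⊆ D := by
    intro y hy
    obtain ⟨x, hx, hxy⟩ := mem_thickening_iff.1 hy
    exact (hDmb x).1 hx hxy
  have hDmv : volume Dm ≤ volume (closedBall (0 : EuclideanSpace ℝ (Fin n)) (R - r)) := by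
    rcases eq_or_ne (volume Dm) 0 with h0 | h0
    · rw [h0]; exact bot_le
    have hsub : Dm ⊆ D := (self_subset_thickening hr _).trans hDmD
    have ht : volume Dm ≠ ∞ := by
      refine ne_top_of_le_ne_top ?_ (measure_mono hsub)
      rw [hDv]; exact measure_ball_lt_top.ne
    obtain ⟨ρ, hρ, hv⟩ := exists_radius hn h0 ht
    have := (bm_ball mDm hρ hr hv).trans (measure_mono hDmD)
    rw [hDv] at this
    have := ball_mono_lt hn hR.le (by linarith) this
    rw [hv]
    exact measure_mono (ball_subset_closedBall.trans (closedBall_subset_closedBall (by linarith)))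
  have hcover : thickening r D ⊆ thickening r (frontier D) ∪ Dm := by
    intro x hx
    by_cases hxm : x ∈ Dm
    · exact Or.inr hxm
    left
    obtain ⟨y, hy, hxy⟩ := mem_thickening_iff.1 hx
    rw [hDmb, not_subset] at hxm
    obtain ⟨z, hz, hzD⟩ := hxm
    have hpc : IsPreconnected (ball x r) := (convex_ball x r).isPreconnected
    have hex : ∃ w ∈ ball x r, w ∈ frontier D := by
      by_contra! hno
      have hy' : y ∈ ball x r := by rwa [mem_ball, dist_comm]
      have split : ∀ w ∈ ball x r, (w ∈ D → w ∈ interior D) ∧ (w ∉ D → w ∈ interior Dᶜ) := by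
        intro w hw
        have := hno w hw
        refine ⟨fun h => ?_, fun h => ?_⟩
        · by_contra hi
          exact this ⟨subset_closure h, hi⟩
        · rw [interior_compl]
          intro hc
          exact this ⟨hc, fun hi => h (interior_subset hi)⟩
      obtain ⟨w, _, hw1, hw2⟩ := hpc (interior D) (interior Dᶜ) isOpen_interior isOpen_interior
        (fun w hw => by
          by_cases h : w ∈ D
          · exact Or.inl ((split w hw).1 h)
          · exact Or.inr ((split w hw).2 h))
        ⟨y, hy', (split y hy').1 hy⟩ ⟨z, hz, (split z hz).2 hzD⟩
      exact interior_subset hw2 (interior_subset hw1)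
    obtain ⟨w, hw, hwf⟩ := hex
    rw [mem_thickening_iff]
    exact ⟨w, hwf, by rwa [mem_ball, dist_comm] at hw⟩
  have hthick : volume (thickening r D) ≤ volume (ball (0 : EuclideanSpace ℝ (Fin n)) (R + r)) := by
    calc _ ≤ volume (thickening r (frontier D)) + volume Dm :=
          (measure_mono hcover).trans (measure_union_le _ _)
      _ ≤ _ := add_le_add hN2 hDmv
      _ = _ := tsub_add_cancel_of_le (measure_mono hcb)
  have hnm : NullMeasurableSet D volume := hE.nullMeasurableSet.congr hDE.symm
  obtain ⟨K, hKD, mK, hK⟩ := hnm.exists_measurable_subset_ae_eq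
  have hKE : K =ᵐ[volume] E := hK.trans hDE
  obtain ⟨p, hp⟩ := rigid mK hR hr (by rw [measure_congr hK, hDv])
    ((measure_mono (thickening_subset_of_subset r hKD)).trans hthick)
  refine ⟨p, ?_⟩
  rw [← hp]
  exact measure_congr ((hKE.symm.diff (ae_eq_refl _)).union ((ae_eq_refl _).diff hKE.symm))
end
end

section
/- Density growth for minimizers: let n ≥ 1, r > 0, Ω ⊆ ℝⁿ be open, and let E be a measurable set which is a minimizer of Per_r in every open ball contained in Ω. Let R_o > 0 with B_{R_o} ⊆ Ω and ω_o := Lⁿ(E ∩ B_{R_o}) > 0. Then there exists c_* > 0, depending only on n, r and ω_o, such that for every k ∈ ℕ with B_{R_o + 2kr} ⊆ Ω one has Lⁿ(E ∩ B_{R_o + 2kr}) ≥ (ω_o^{1/n} + 2 c_* k r)^n. Moreover: if n = 1 then c_* may be taken to be an absolute constant independent of r and ω_o; and for every c̲ > 0 there exists c_* > 0 depending only on n and c̲ for which the estimate holds whenever ω_o ≥ c̲ rⁿ. -/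
open MeasureTheory Metric Set Filter Topology
open scoped RealInnerProductSpace ENNReal

noncomputable section

/-- The inner domain `D ⊖ B_r = {x ∈ D : dist(x, ∂D) ≥ r}`. -/
def innerDomain (n : ℕ) (r : ℝ) (D : Set (EuclideanSpace ℝ (Fin n))) :
    Set (EuclideanSpace ℝ (Fin n)) :=
  {x ∈ D | r ≤ Metric.infDist x (frontier D)}

/-- `E` is a minimizer of `Per_r` in `D`: it minimizes among measurable competitors that
coincide with `E` outside `D ⊖ B_r`. -/
def IsMinimizerPerR (n : ℕ) (r : ℝ) (E D : Set (EuclideanSpace ℝ (Fin n))) : Prop :=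
  ∀ F : Set (EuclideanSpace ℝ (Fin n)), MeasurableSet F →
    F \ innerDomain n r D = E \ innerDomain n r D → perR n r E D ≤ perR n r F D

/-- The density growth estimate with constant `c`: for any open `Ω`, any measurable set `E`
minimizing `Per_r` in every open ball contained in `Ω`, any `R_o > 0` with `B_{R_o} ⊆ Ω` and
`Lⁿ(E ∩ B_{R_o}) = ω_o`, and any `k ∈ ℕ` with `B_{R_o + 2kr} ⊆ Ω`, one has
`Lⁿ(E ∩ B_{R_o + 2kr}) ≥ (ω_o^{1/n} + 2 c k r)^n`. -/
def DensityGrowth (n : ℕ) (r ωo c : ℝ) : Prop :=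
  ∀ Ω : Set (EuclideanSpace ℝ (Fin n)), IsOpen Ω →
  ∀ E : Set (EuclideanSpace ℝ (Fin n)), MeasurableSet E →
    (∀ (x : EuclideanSpace ℝ (Fin n)) (ρ : ℝ), 0 < ρ → ball x ρ ⊆ Ω →
      IsMinimizerPerR n r E (ball x ρ)) →
  ∀ Ro : ℝ, 0 < Ro → ball (0 : EuclideanSpace ℝ (Fin n)) Ro ⊆ Ω →
    volume (E ∩ ball (0 : EuclideanSpace ℝ (Fin n)) Ro) = ENNReal.ofReal ωo →
  ∀ k : ℕ, ball (0 : EuclideanSpace ℝ (Fin n)) (Ro + 2 * k * r) ⊆ Ω →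
    ENNReal.ofReal ((ωo ^ (1 / (n : ℝ)) + 2 * c * k * r) ^ n) ≤
      volume (E ∩ ball (0 : EuclideanSpace ℝ (Fin n)) (Ro + 2 * k * r))


section helpers

lemma iso_aux1 {n : ℕ} (K : Set (EuclideanSpace ℝ (Fin n))) (hK : MeasurableSet K)  :
    ∫⁻ y, volume (K ∩ (fun x => x + y) ⁻¹' K) = volume K * volume K := by
  have h1 : ∀ y : EuclideanSpace ℝ (Fin n), volume (K ∩ (fun x => x + y) ⁻¹' K)
      = ∫⁻ x, K.indicator 1 x * K.indicator (1 : EuclideanSpace ℝ (Fin n) → ℝ≥0∞) (x + y) := by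
    intro y
    have hm : MeasurableSet (K ∩ (fun x => x + y) ⁻¹' K) :=
      hK.inter (measurable_add_const y hK)
    rw [← lintegral_indicator_one hm]
    congr 1
    ext x
    by_cases h1 : x ∈ K <;> by_cases h2 : x + y ∈ K <;> simp [h1, h2, Set.indicator]
  simp_rw [h1]
  have hmi : Measurable (K.indicator (1 : EuclideanSpace ℝ (Fin n) → ℝ≥0∞)) := measurable_one.indicator hK
  rw [lintegral_lintegral_swap]
  · have h2 : ∀ x : EuclideanSpace ℝ (Fin n),
        ∫⁻ y, K.indicator 1 x * K.indicator (1 : EuclideanSpace ℝ (Fin n) → ℝ≥0∞) (x + y)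
        = K.indicator 1 x * volume K := by
      intro x
      rw [lintegral_const_mul _ (by fun_prop)]
      rw [lintegral_add_left_eq_self (fun y => K.indicator (1 : EuclideanSpace ℝ (Fin n) → ℝ≥0∞) y),
        lintegral_indicator_one hK]
    simp_rw [h2]
    rw [lintegral_mul_const _ hmi, lintegral_indicator_one hK]
  · apply Measurable.aemeasurable
    apply Measurable.mul
    · exact hmi.comp measurable_snd
    · exact hmi.comp (measurable_snd.add measurable_fst)

lemma iso_aux2 {n : ℕ} (K : Set (EuclideanSpace ℝ (Fin n)))
    (z : EuclideanSpace ℝ (Fin n)) (N : ℕ) :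
    volume ((fun x => x + (N : ℝ) • z) ⁻¹' K \ K) ≤ N * volume ((fun x => x + z) ⁻¹' K \ K) := by
  induction N with
  | zero => simp
  | succ N ih =>
    have hsub : (fun x => x + ((N + 1 : ℕ) : ℝ) • z) ⁻¹' K \ K ⊆
        ((fun x => x + z) ⁻¹' ((fun x => x + (N : ℝ) • z) ⁻¹' K \ K)) ∪
          ((fun x => x + z) ⁻¹' K \ K) := by
      intro x hx
      have e : x + ((N + 1 : ℕ) : ℝ) • z = x + z + (N : ℝ) • z := by
        push_cast; rw [add_smul, one_smul]; abel
      simp only [Set.mem_sdiff, mem_preimage, mem_union] at hx ⊢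
      rw [e] at hx
      tauto
    refine (measure_mono hsub).trans ((measure_union_le _ _).trans ?_)
    rw [measure_preimage_add_right]
    push_cast
    rw [add_mul, one_mul]
    gcongr

lemma iso_main {n : ℕ} (K : Set (EuclideanSpace ℝ (Fin n))) (hK : MeasurableSet K)
    (hfin : volume K ≠ ⊤) (r ρ : ℝ) (hr : 0 < r) (N : ℕ) (hN : 1 ≤ N) (hρ : ρ ≤ N * r)
    (hb : 4 * volume K ≤ volume (ball (0 : EuclideanSpace ℝ (Fin n)) ρ)) :
    volume.real K + volume.real K / (2 * N) ≤ volume.real (thickening r K) ∨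
      volume (thickening r K) = ⊤ := by
  by_cases htop : volume (thickening r K) = ⊤
  · exact Or.inr htop
  left
  have hN0 : (0:ℝ) < N := by exact_mod_cast hN
  have hself : K ⊆ thickening r K := self_subset_thickening hr K
  rcases eq_or_ne (volume K) 0 with h0 | h0
  · have : volume.real K = 0 := by simp [measureReal_def, h0]
    rw [this]; simp
  have hmpos : 0 < volume.real K := by
    rw [measureReal_def]; exact ENNReal.toReal_pos h0 hfin
  obtain ⟨y, hy, hyK⟩ : ∃ y ∈ ball (0 : EuclideanSpace ℝ (Fin n)) ρ,
      volume (K ∩ (fun x => x + y) ⁻¹' K) ≤ volume K / 2 := by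
    by_contra hcon
    push Not at hcon
    have h1 : volume K / 2 * volume (ball (0 : EuclideanSpace ℝ (Fin n)) ρ) ≤
        volume K * volume K := by
      rw [← iso_aux1 K hK, ← setLIntegral_const]
      refine (setLIntegral_mono' measurableSet_ball (fun y hy => (hcon y hy).le)).trans ?_
      exact setLIntegral_le_lintegral _ _
    have h2 : volume K / 2 * (4 * volume K) ≤ volume K * volume K :=
      (by gcongr : volume K / 2 * (4 * volume K) ≤ volume K / 2 * volume (ball (0 : EuclideanSpace ℝ (Fin n)) ρ)).trans h1
    have h3 := ENNReal.toReal_mono (ENNReal.mul_ne_top hfin hfin) h2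
    simp only [ENNReal.toReal_mul, ENNReal.toReal_div] at h3
    rw [measureReal_def] at hmpos
    norm_num at h3
    nlinarith
  set z : EuclideanSpace ℝ (Fin n) := (N : ℝ)⁻¹ • y with hz
  have hzy : (N : ℝ) • z = y := by rw [hz, smul_smul, mul_inv_cancel₀ hN0.ne', one_smul]
  have hzn : ‖z‖ < r := by
    rw [hz, norm_smul, norm_inv, Real.norm_natCast, inv_mul_lt_iff₀ hN0]
    rw [mem_ball_zero_iff] at hy
    linarith
  have hsub : K ∪ ((fun x => x + z) ⁻¹' K \ K) ⊆ thickening r K := by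
    rintro x (hx | ⟨hx, -⟩)
    · exact hself hx
    · rw [mem_thickening_iff]
      exact ⟨x + z, hx, by simpa [dist_eq_norm] using hzn⟩
  have hmz : MeasurableSet ((fun x => x + z) ⁻¹' K) := measurable_add_const z hK
  have hmy : MeasurableSet ((fun x => x + y) ⁻¹' K) := measurable_add_const y hK
  have hfz : volume ((fun x => x + z) ⁻¹' K \ K) ≠ ⊤ := by
    apply ne_top_of_le_ne_top _ (measure_mono sdiff_subset)
    rw [measure_preimage_add_right]; exact hfin
  have hA : volume.real K + volume.real ((fun x => x + z) ⁻¹' K \ K) ≤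
      volume.real (thickening r K) := by
    rw [← measureReal_union disjoint_sdiff_right (hmz.diff hK) hfin hfz]
    exact measureReal_mono hsub htop
  have hB := iso_aux2 K z N
  rw [hzy] at hB
  have hB' : volume.real ((fun x => x + y) ⁻¹' K \ K) ≤
      N * volume.real ((fun x => x + z) ⁻¹' K \ K) := by
    have := ENNReal.toReal_mono (ENNReal.mul_ne_top (by simp) hfz) hB
    simpa [measureReal_def] using this
  have hC : volume.real K = volume.real ((fun x => x + y) ⁻¹' K \ K) +
      volume.real (K ∩ (fun x => x + y) ⁻¹' K) := by
    have e : volume.real ((fun x => x + y) ⁻¹' K) = volume.real K := by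
      rw [measureReal_def, measure_preimage_add_right, measureReal_def]
    have hf : volume ((fun x => x + y) ⁻¹' K) ≠ ⊤ := by
      rw [measure_preimage_add_right]; exact hfin
    rw [inter_comm, add_comm, measureReal_inter_add_sdiff hK hf, e]
  have hD : volume.real (K ∩ (fun x => x + y) ⁻¹' K) ≤ volume.real K / 2 := by
    have := ENNReal.toReal_mono (ENNReal.div_ne_top hfin (by simp)) hyK
    simpa [measureReal_def] using this
  have : volume.real K / (2 * N) ≤ volume.real ((fun x => x + z) ⁻¹' K \ K) := by
    rw [div_le_iff₀ (by positivity)]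
    linarith
  linarith

end helpers

section geometry

lemma dens_ae {n : ℕ} (hn : 1 ≤ n) (E : Set (EuclideanSpace ℝ (Fin n))) (hE : MeasurableSet E) :
    densityOnePoints n E =ᵐ[volume] E := by
  have : Nonempty (Fin n) := ⟨⟨0, hn⟩⟩
  filter_upwards [Besicovitch.ae_tendsto_measure_inter_div_of_measurableSet volume hE] with x hx
  have key : Tendsto (fun ρ : ℝ => volume (E ∩ ball x ρ) / volume (ball x ρ)) (𝓝[>] 0)
      (𝓝 (E.indicator 1 x)) := by
    refine hx.congr (fun ρ => ?_)
    have h1 : (closedBall x ρ : Set (EuclideanSpace ℝ (Fin n))) =ᵐ[volume] ball x ρ := by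
      rw [← ball_union_sphere]
      exact union_ae_eq_left_of_ae_eq_empty
        (ae_eq_empty.2 (Measure.addHaar_sphere volume x ρ))
    rw [measure_congr h1, measure_congr ((ae_eq_refl E).inter h1)]
  apply propext
  change Tendsto _ _ _ ↔ x ∈ E
  constructor
  · intro h
    by_contra hxE
    have := tendsto_nhds_unique h key
    simp [hxE] at this
  · intro h
    simpa [h] using key

lemma dens_mono {n : ℕ} {E F : Set (EuclideanSpace ℝ (Fin n))} (h : F ⊆ E) :
    densityOnePoints n F ⊆ densityOnePoints n E := by
  intro x hx
  change Tendsto _ _ _ at hx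
  change Tendsto _ _ _
  refine tendsto_of_tendsto_of_tendsto_of_le_of_le hx tendsto_const_nhds ?_ ?_
  · intro ρ
    dsimp only
    gcongr
  · intro ρ
    dsimp only
    exact (ENNReal.div_le_div_right (measure_mono inter_subset_right) _).trans ENNReal.div_self_le_one

lemma dens_disj {n : ℕ} {F U : Set (EuclideanSpace ℝ (Fin n))} (hU : IsOpen U)
    (h : Disjoint F U) : Disjoint (densityOnePoints n F) U := by
  rw [Set.disjoint_left]
  intro x hx hxU
  change Tendsto _ _ _ at hx
  obtain ⟨ε, hε, hb⟩ := Metric.isOpen_iff.1 hU x hxU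
  have h0 : Tendsto (fun ρ : ℝ => volume (F ∩ ball x ρ) / volume (ball x ρ)) (𝓝[>] 0) (𝓝 0) := by
    apply tendsto_const_nhds.congr'
    filter_upwards [Ioo_mem_nhdsGT hε] with ρ hρ
    have : F ∩ ball x ρ = ∅ :=
      (h.mono_right ((ball_subset_ball hρ.2.le).trans hb)).inter_eq
    simp [this]
  exact zero_ne_one (tendsto_nhds_unique h0 hx)

lemma ball_alt {n : ℕ} {A : Set (EuclideanSpace ℝ (Fin n))} {x : EuclideanSpace ℝ (Fin n)} {r : ℝ}
    (hx : x ∉ thickening r (frontier A)) : ball x r ⊆ A ∨ Disjoint A (ball x r) := by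
  by_contra hcon
  push Not at hcon
  obtain ⟨h1, h2⟩ := hcon
  have hp : IsPreconnected (ball x r) := (convex_ball x r).isPreconnected
  have hcov : ∀ y ∈ ball x r, y ∈ interior A ∨ y ∈ (closure A)ᶜ := by
    intro y hy
    by_contra hc
    push Not at hc
    apply hx
    rw [mem_thickening_iff]
    exact ⟨y, ⟨by simpa using hc.2, hc.1⟩, by rw [dist_comm]; exact hy⟩
  obtain ⟨p, hp1, hp2⟩ := Set.not_disjoint_iff.1 h2
  obtain ⟨q, hq1, hq2⟩ := Set.not_subset.1 h1
  have hpi : p ∈ interior A := (hcov p hp2).resolve_right (fun h => h (subset_closure hp1))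
  have hqi : q ∈ (closure A)ᶜ := (hcov q hq1).resolve_left (fun h => hq2 (interior_subset h))
  obtain ⟨y, -, hy1, hy2⟩ := hp _ _ isOpen_interior isClosed_closure.isOpen_compl hcov
    ⟨p, hp2, hpi⟩ ⟨q, hq1, hqi⟩
  exact hy2 (subset_closure (interior_subset hy1))

lemma min_ineq {n : ℕ} (hn : 1 ≤ n) {r R : ℝ} (hr : 0 < r) (hR : 0 < R)
    {E : Set (EuclideanSpace ℝ (Fin n))} (hE : MeasurableSet E)
    (hmin : IsMinimizerPerR n r E (ball 0 (R + 2 * r))) :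
    volume (thickening r (frontier (densityOnePoints n E)) ∩ ball 0 R) ≤
      volume {x | x ∈ ball (0 : EuclideanSpace ℝ (Fin n)) (R + 2 * r) \ ball 0 R ∧
        ball x r ⊆ densityOnePoints n E} := by
  have : Nonempty (Fin n) := ⟨⟨0, hn⟩⟩
  set D : Set (EuclideanSpace ℝ (Fin n)) := ball 0 (R + 2 * r) with hD
  set F := E \ ball 0 (R + r) with hF
  have hFm : MeasurableSet F := hE.diff measurableSet_ball
  have hinner : ball 0 (R + r) ⊆ innerDomain n r D := by
    intro x hx
    refine ⟨ball_subset_ball (by linarith) hx, ?_⟩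
    rw [hD, frontier_ball _ (by positivity)]
    rw [le_infDist (NormedSpace.sphere_nonempty.2 (by positivity))]
    intro y hy
    rw [mem_sphere_zero_iff_norm] at hy
    rw [mem_ball_zero_iff] at hx
    have := norm_sub_norm_le y x
    rw [dist_eq_norm, norm_sub_rev]
    linarith
  have hFE : F \ innerDomain n r D = E \ innerDomain n r D := by
    ext x
    have := @hinner x
    simp only [hF, Set.mem_sdiff]
    tauto
  have h1 := hmin F hFm hFE
  unfold perR at h1
  set T := thickening r (frontier (densityOnePoints n E)) with hT
  set T' := thickening r (frontier (densityOnePoints n F)) with hT'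
  have h2 : volume (T ∩ D) ≤ volume (T' ∩ D) :=
    (ENNReal.mul_le_mul_iff_left (ENNReal.inv_ne_zero.2 ENNReal.ofReal_ne_top)
      (ENNReal.inv_ne_top.2 (by simpa using hr))).1 h1
  have hTm : MeasurableSet T := isOpen_thickening.measurableSet
  have hDfin : volume D ≠ ⊤ := measure_ball_lt_top.ne
  have hdisj : Disjoint (densityOnePoints n F) (ball 0 (R + r)) :=
    dens_disj isOpen_ball disjoint_sdiff_left
  have hT'R : ∀ x ∈ T', x ∉ ball (0 : EuclideanSpace ℝ (Fin n)) R := by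
    intro x hx hxR
    rw [hT', mem_thickening_iff] at hx
    obtain ⟨y, hy, hxy⟩ := hx
    have hyb : y ∈ ball (0 : EuclideanSpace ℝ (Fin n)) (R + r) := by
      rw [mem_ball] at hxR ⊢
      have := dist_triangle_left y 0 x
      linarith
    have := (hdisj.closure_left isOpen_ball)
    exact Set.disjoint_left.1 this (frontier_subset_closure hy) hyb
  have hsub : (T' \ T) ∩ D ⊆ {x | x ∈ D \ ball 0 R ∧ ball x r ⊆ densityOnePoints n E} := by
    rintro x ⟨⟨hx1, hx2⟩, hxD⟩
    refine ⟨⟨hxD, hT'R x hx1⟩, ?_⟩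
    rcases ball_alt hx2 with h | h
    · exact h
    · exfalso
      have h' : Disjoint (densityOnePoints n F) (ball x r) :=
        h.mono_left (dens_mono sdiff_subset)
      rw [hT', mem_thickening_iff] at hx1
      obtain ⟨y, hy, hxy⟩ := hx1
      exact Set.disjoint_left.1 (h'.closure_left isOpen_ball) (frontier_subset_closure hy)
        (by rw [mem_ball, dist_comm]; exact hxy)
  refine le_trans ?_ (measure_mono hsub)
  -- cancel
  have h3 : volume (T ∩ ball 0 R) + volume ((T ∩ D) \ ball 0 R) ≤ volume (T ∩ D) := by
    rw [← measure_inter_add_sdiff (T ∩ D) (measurableSet_ball : MeasurableSet (ball (0 : EuclideanSpace ℝ (Fin n)) R))]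
    refine add_le_add (measure_mono ?_) le_rfl
    intro x hx
    exact ⟨⟨hx.1, ball_subset_ball (by linarith) hx.2⟩, hx.2⟩
  have h4 : volume (T' ∩ D) ≤ volume ((T' \ T) ∩ D) + volume ((T ∩ D) \ ball 0 R) := by
    refine (measure_mono ?_).trans (measure_union_le _ _)
    rintro x ⟨hx, hxD⟩
    by_cases hxT : x ∈ T
    · exact Or.inr ⟨⟨hxT, hxD⟩, hT'R x hx⟩
    · exact Or.inl ⟨⟨hx, hxT⟩, hxD⟩
  have hfin : volume ((T ∩ D) \ ball 0 R) ≠ ⊤ :=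
    ne_top_of_le_ne_top hDfin (measure_mono (fun x hx => hx.1.2))
  exact (ENNReal.add_le_add_iff_right hfin).1 (h3.trans (h2.trans h4))

end geometry

section steps

lemma real_dens {n : ℕ} (hn : 1 ≤ n) {E : Set (EuclideanSpace ℝ (Fin n))} (hE : MeasurableSet E)
    (B : Set (EuclideanSpace ℝ (Fin n))) :
    volume (E ∩ B) = volume (densityOnePoints n E ∩ B) :=
  measure_congr ((dens_ae hn E hE).symm.inter (ae_eq_refl B))

lemma step_lemma {n : ℕ} (hn : 1 ≤ n) {r R : ℝ} (hr : 0 < r) (hR : 0 < R)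
    {E : Set (EuclideanSpace ℝ (Fin n))} (hE : MeasurableSet E)
    (hmin : IsMinimizerPerR n r E (ball 0 (R + 2 * r)))
    (ha : 0 < volume.real (E ∩ ball 0 R)) :
    (∀ (N : ℕ) (ρ : ℝ), 1 ≤ N → ρ ≤ N * r →
      4 * volume.real (E ∩ ball 0 R) ≤ volume.real (ball (0 : EuclideanSpace ℝ (Fin n)) ρ) →
      volume.real (E ∩ ball 0 R) * (1 + 1 / (8 * N)) ≤ volume.real (E ∩ ball 0 (R + 2 * r))) ∧
    volume.real (ball (0 : EuclideanSpace ℝ (Fin n)) (r / 2)) ≤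
      volume.real (E ∩ ball 0 (R + 2 * r)) := by
  have hmi := min_ineq hn hr hR hE hmin
  have hcE := real_dens hn hE
  have hnull : NullMeasurableSet (densityOnePoints n E) volume :=
    hE.nullMeasurableSet.congr (dens_ae hn E hE).symm
  have hrE : ∀ B, volume.real (E ∩ B) = volume.real (densityOnePoints n E ∩ B) := by
    intro B; rw [measureReal_def, hcE, measureReal_def]
  rw [hrE, hrE] at *
  set G := densityOnePoints n E with hG
  set T := thickening r (frontier G) with hT
  have hTm : MeasurableSet T := isOpen_thickening.measurableSet
  have fin : ∀ (A : Set (EuclideanSpace ℝ (Fin n))) (s : ℝ), A ⊆ ball 0 s → volume A ≠ ⊤ :=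
    fun A s h => ne_top_of_le_ne_top measure_ball_lt_top.ne (measure_mono h)
  have hfa' : volume (G ∩ ball 0 (R + 2 * r)) ≠ ⊤ := fin _ _ inter_subset_right
  have hfa : volume (G ∩ ball 0 R) ≠ ⊤ := fin _ _ inter_subset_right
  set K := (G ∩ ball 0 R) \ T with hK
  have hKball : ∀ x ∈ K, ball x r ⊆ G := by
    rintro x ⟨⟨hxG, -⟩, hxT⟩
    rcases ball_alt hxT with h | h
    · exact h
    · exact absurd (mem_ball_self hr) (Set.disjoint_left.1 h hxG)
  have hKnull : NullMeasurableSet K volume :=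
    (hnull.inter measurableSet_ball.nullMeasurableSet).diff hTm.nullMeasurableSet
  have hKfin : volume K ≠ ⊤ := ne_top_of_le_ne_top hfa (measure_mono sdiff_subset)
  set P : Set (EuclideanSpace ℝ (Fin n)) :=
    {x | x ∈ ball (0 : EuclideanSpace ℝ (Fin n)) (R + 2 * r) \ ball 0 R ∧ ball x r ⊆ G} with hP
  have hPsub : P ⊆ (G ∩ ball 0 (R + 2 * r)) \ ball 0 R := fun x hx =>
    ⟨⟨hx.2 (mem_ball_self hr), hx.1.1⟩, hx.1.2⟩
  have hsplit : volume.real (G ∩ ball 0 (R + 2 * r)) = volume.real (G ∩ ball 0 R) +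
      volume.real ((G ∩ ball 0 (R + 2 * r)) \ ball 0 R) := by
    rw [← measureReal_inter_add_sdiff (measurableSet_ball : MeasurableSet
      (ball (0 : EuclideanSpace ℝ (Fin n)) R)) hfa', inter_assoc,
      inter_eq_self_of_subset_right (ball_subset_ball (by linarith : R ≤ R + 2 * r))]
  have hsplit2 : volume.real (G ∩ ball 0 R) = volume.real (G ∩ ball 0 R ∩ T) + volume.real K :=
    (measureReal_inter_add_sdiff hTm hfa).symm
  have hPfin : volume P ≠ ⊤ := fin _ (R + 2 * r) (fun x hx => hx.1.1)
  have ht : volume.real (G ∩ ball 0 R ∩ T) ≤ volume.real ((G ∩ ball 0 (R + 2 * r)) \ ball 0 R) := by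
    have h1 : volume (G ∩ ball 0 R ∩ T) ≤ volume P :=
      le_trans (measure_mono (show G ∩ ball 0 R ∩ T ⊆ T ∩ ball 0 R from
        fun x hx => ⟨hx.2, hx.1.2⟩)) hmi
    have h2 := h1.trans (measure_mono hPsub)
    exact ENNReal.toReal_mono (ne_top_of_le_ne_top hfa' (measure_mono sdiff_subset)) h2
  constructor
  · intro N ρ hN hρ h4
    obtain ⟨K', hK'K, hK'm, hK'e⟩ := hKnull.exists_measurable_subset_ae_eq
    have hv : volume K' = volume K := measure_congr hK'e
    have hvr : volume.real K' = volume.real K := by rw [measureReal_def, hv, measureReal_def]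
    have hth : thickening r K' ⊆ G ∩ ball 0 (R + 2 * r) := by
      intro y hy
      rw [mem_thickening_iff] at hy
      obtain ⟨x, hx, hxy⟩ := hy
      refine ⟨hKball x (hK'K hx) hxy, ?_⟩
      have h1 : x ∈ ball (0 : EuclideanSpace ℝ (Fin n)) R := (hK'K hx).1.2
      rw [mem_ball] at h1 ⊢
      have := dist_triangle y x 0
      linarith
    have hKa : volume.real K ≤ volume.real (G ∩ ball 0 R) := measureReal_mono sdiff_subset hfa
    have hiso := iso_main K' hK'm (hv ▸ hKfin) r ρ hr N hN hρ (by
      rw [hv]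
      rw [← ENNReal.toReal_le_toReal (ENNReal.mul_ne_top (by simp) hKfin) measure_ball_lt_top.ne]
      rw [ENNReal.toReal_mul]
      simp only [measureReal_def] at h4 hKa
      norm_num
      linarith)
    have hiso' := hiso.resolve_right (ne_top_of_le_ne_top hfa' (measure_mono hth))
    have hle := hiso'.trans (measureReal_mono hth hfa')
    rw [hvr] at hle
    have hN1 : (1:ℝ) ≤ N := by exact_mod_cast hN
    have hinv : (1:ℝ) / N ≤ 1 := by rw [div_le_one (by linarith)]; exact hN1
    have hinv0 : 0 < (1:ℝ) / N := by positivity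
    have e1 : volume.real K / (2 * N) = volume.real K * (1 / N) / 2 := by field_simp
    have e2 : (1:ℝ) / (8 * N) = (1 / N) / 8 := by field_simp
    rw [e1] at hle
    rw [e2]
    set u := (1:ℝ) / N
    set a := volume.real (G ∩ ball 0 R)
    set a' := volume.real (G ∩ ball 0 (R + 2 * r))
    set m := volume.real K
    have h5 : a + (a - m) ≤ a' := by linarith
    by_cases hm : a / 2 ≤ m
    · nlinarith
    · push Not at hm
      nlinarith
  · suffices h : ∃ x ∈ ball (0 : EuclideanSpace ℝ (Fin n)) (R + 2 * r), ball x r ⊆ G by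
      obtain ⟨x, hx, hxG⟩ := h
      have hR2 : r / 2 ≤ R + 2 * r := by linarith
      obtain ⟨y, hy⟩ : ∃ y : EuclideanSpace ℝ (Fin n), dist y x ≤ r / 2 ∧
          ‖y‖ + r / 2 ≤ R + 2 * r := by
        set S := R + 2 * r with hS
        have hSpos : 0 < S := by positivity
        rw [mem_ball_zero_iff] at hx
        refine ⟨(1 - r / (2 * S)) • x, ?_, ?_⟩
        · rw [dist_eq_norm, sub_smul, one_smul, sub_sub_cancel_left, norm_neg, norm_smul,
            Real.norm_of_nonneg (by positivity)]
          calc r / (2 * S) * ‖x‖ ≤ r / (2 * S) * S := by gcongr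
            _ = r / 2 := by field_simp
        · have h0 : 0 ≤ 1 - r / (2 * S) := by
            rw [sub_nonneg, div_le_one (by positivity)]; linarith
          rw [norm_smul, Real.norm_of_nonneg h0]
          have : (1 - r / (2 * S)) * ‖x‖ ≤ (1 - r / (2 * S)) * S := by gcongr
          have e : (1 - r / (2 * S)) * S = S - r / 2 := by field_simp
          linarith
      have hsub : ball y (r / 2) ⊆ G ∩ ball 0 (R + 2 * r) := by
        intro w hw
        rw [mem_ball] at hw
        refine ⟨hxG ?_, ?_⟩
        · rw [mem_ball]
          have := dist_triangle w y x
          linarith [hy.1]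
        · rw [mem_ball]
          have := dist_triangle w y 0
          rw [dist_zero_right y] at this
          linarith [hy.2]
      calc volume.real (ball (0 : EuclideanSpace ℝ (Fin n)) (r / 2))
          = volume.real (ball y (r / 2)) := by
            rw [measureReal_def, measureReal_def, Measure.addHaar_ball_center volume y]
        _ ≤ _ := measureReal_mono hsub hfa'
    by_contra hcon
    push Not at hcon
    have hKe : K = ∅ := by
      rw [eq_empty_iff_forall_notMem]
      intro x hx
      exact hcon x (ball_subset_ball (by linarith) hx.1.2) (hKball x hx)
    have hPe : P = ∅ := by
      rw [eq_empty_iff_forall_notMem]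
      intro x hx
      exact hcon x hx.1.1 hx.2
    have h1 : volume (G ∩ ball 0 R ∩ T) = 0 := by
      have : volume (G ∩ ball 0 R ∩ T) ≤ volume P :=
        le_trans (measure_mono (show G ∩ ball 0 R ∩ T ⊆ T ∩ ball 0 R from
        fun x hx => ⟨hx.2, hx.1.2⟩)) hmi
      rw [hPe] at this
      simpa using this
    have h2 : volume.real (G ∩ ball 0 R ∩ T) = 0 := by rw [measureReal_def, h1]; rfl
    rw [hsplit2, h2, hKe] at ha
    simp at ha

lemma one_add_pow_bound (n : ℕ) (s : ℝ) (h0 : 0 ≤ s) (h1 : s ≤ 1) :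
    (1 + s) ^ n ≤ 1 + (2 ^ n - 1) * s := by
  induction n with
  | zero => simp
  | succ n ih =>
    have h2 : (1:ℝ) ≤ 2 ^ n := one_le_pow₀ (by norm_num)
    rw [pow_succ, pow_succ]
    nlinarith [mul_nonneg (mul_nonneg (sub_nonneg.2 h2) h0) (sub_nonneg.2 h1)]

lemma iterate_lemma {n : ℕ} (hn : 1 ≤ n) {r ωo c : ℝ} (hr : 0 < r) (hω : 0 < ωo) (hc : 0 < c)
    (hstep : ∀ (E : Set (EuclideanSpace ℝ (Fin n))), MeasurableSet E → ∀ R : ℝ, 0 < R →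
      IsMinimizerPerR n r E (ball 0 (R + 2 * r)) → ωo ≤ volume.real (E ∩ ball 0 R) →
      ((volume.real (E ∩ ball 0 R)) ^ (1 / (n : ℝ)) + 2 * c * r) ^ n ≤
        volume.real (E ∩ ball 0 (R + 2 * r))) :
    DensityGrowth n r ωo c := by
  intro Ω hΩ E hE hmin Ro hRo hball hvol k hk
  have hn0 : (n : ℝ) ≠ 0 := by positivity
  have fin : ∀ s : ℝ, volume (E ∩ ball 0 s) ≠ ⊤ :=
    fun s => ne_top_of_le_ne_top measure_ball_lt_top.ne (measure_mono inter_subset_right)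
  have hω1 : (ωo ^ (1 / (n : ℝ))) ^ n = ωo := by
    rw [one_div, Real.rpow_inv_natCast_pow hω.le (by omega)]
  have hx0 : 0 < ωo ^ (1 / (n : ℝ)) := Real.rpow_pos_of_pos hω _
  suffices h : (ωo ^ (1 / (n : ℝ)) + 2 * c * k * r) ^ n ≤
      volume.real (E ∩ ball 0 (Ro + 2 * k * r)) by
    rw [measureReal_def] at h
    exact ENNReal.ofReal_le_of_le_toReal h
  induction k with
  | zero =>
    simp only [Nat.cast_zero, mul_zero, zero_mul, add_zero, measureReal_def]
    rw [hvol, hω1, ENNReal.toReal_ofReal hω.le]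
  | succ k ih =>
    have e : Ro + 2 * ((k + 1 : ℕ) : ℝ) * r = (Ro + 2 * k * r) + 2 * r := by push_cast; ring
    rw [e] at hk ⊢
    have hih := ih ((ball_subset_ball (by linarith)).trans hk)
    have hRk : 0 < Ro + 2 * k * r := by positivity
    have hmk := hmin 0 (Ro + 2 * k * r + 2 * r) (by positivity) hk
    have hge : ωo ≤ volume.real (E ∩ ball 0 (Ro + 2 * k * r)) := by
      refine le_trans ?_ hih
      calc ωo = (ωo ^ (1 / (n : ℝ))) ^ n := hω1.symm
        _ ≤ _ := by
          gcongr
          have : 0 ≤ 2 * c * k * r := by positivity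
          linarith
    refine le_trans ?_ (hstep E hE _ hRk hmk hge)
    have hroot : ωo ^ (1 / (n : ℝ)) + 2 * c * k * r ≤
        (volume.real (E ∩ ball 0 (Ro + 2 * k * r))) ^ (1 / (n : ℝ)) := by
      have := Real.rpow_le_rpow (by positivity) hih (by positivity : 0 ≤ 1 / (n : ℝ))
      rwa [one_div (n : ℝ), Real.pow_rpow_inv_natCast (by positivity) (by omega), ← one_div] at this
    have e2 : ωo ^ (1 / (n : ℝ)) + 2 * c * ((k + 1 : ℕ) : ℝ) * r =
      (ωo ^ (1 / (n : ℝ)) + 2 * c * k * r) + 2 * c * r := by push_cast; ring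
    rw [e2]
    gcongr

lemma step_const {n : ℕ} (hn : 1 ≤ n) (cbar : ℝ) (hcb : 0 < cbar) :
    ∃ c : ℝ, 0 < c ∧ ∀ r : ℝ, 0 < r →
    ∀ (E : Set (EuclideanSpace ℝ (Fin n))), MeasurableSet E → ∀ R : ℝ, 0 < R →
      IsMinimizerPerR n r E (ball 0 (R + 2 * r)) → cbar * r ^ n ≤ volume.real (E ∩ ball 0 R) →
      ((volume.real (E ∩ ball 0 R)) ^ (1 / (n : ℝ)) + 2 * c * r) ^ n ≤
        volume.real (E ∩ ball 0 (R + 2 * r)) := by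
  have : Nonempty (Fin n) := ⟨⟨0, hn⟩⟩
  have hn0 : n ≠ 0 := by omega
  set v := volume.real (ball (0 : EuclideanSpace ℝ (Fin n)) 1) with hv
  have hvpos : 0 < v := by
    rw [hv, measureReal_def]
    exact ENNReal.toReal_pos (measure_ball_pos _ _ one_pos).ne' measure_ball_lt_top.ne
  set β := (4 / v) ^ ((n : ℝ)⁻¹) with hβ
  have hβpos : 0 < β := Real.rpow_pos_of_pos (by positivity) _
  have hβn : β ^ n = 4 / v := Real.rpow_inv_natCast_pow (by positivity) hn0
  set γ := cbar ^ ((n : ℝ)⁻¹) with hγ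
  have hγpos : 0 < γ := Real.rpow_pos_of_pos hcb _
  have hγn : γ ^ n = cbar := Real.rpow_inv_natCast_pow hcb.le hn0
  set M := β + 1 / γ with hM
  have hMpos : 0 < M := by positivity
  refine ⟨1 / (2 ^ n * 16 * M), by positivity, ?_⟩
  intro r hr E hE R hR hmin hge
  set a := volume.real (E ∩ ball 0 R) with ha
  have hapos : 0 < a := lt_of_lt_of_le (by positivity) hge
  set x := a ^ (1 / (n : ℝ)) with hx
  have hxpos : 0 < x := Real.rpow_pos_of_pos hapos _
  have hxn : x ^ n = a := by rw [hx, one_div, Real.rpow_inv_natCast_pow hapos.le hn0]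
  have hγx : γ * r ≤ x := by
    apply le_of_pow_le_pow_left₀ hn0 hxpos.le
    rw [mul_pow, hγn, hxn]; exact hge
  have hρpos : 0 < β * x := by positivity
  set N := ⌈β * x / r⌉₊ with hN
  have hN1 : 1 ≤ N := Nat.one_le_iff_ne_zero.2 (Nat.ceil_pos.2 (by positivity)).ne'
  have hNge : β * x ≤ N * r := by
    rw [← div_le_iff₀ hr]; exact Nat.le_ceil _
  have hNle : (N : ℝ) ≤ β * x / r + 1 := (Nat.ceil_lt_add_one (by positivity)).le
  have hst := (step_lemma hn hr hR hE hmin hapos).1 N (β * x) hN1 hNge (by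
    rw [← ha]
    have hb : volume.real (ball (0 : EuclideanSpace ℝ (Fin n)) (β * x)) = (β * x) ^ n * v := by
      rw [measureReal_def, Measure.addHaar_ball _ _ hρpos.le, ENNReal.toReal_mul,
        ENNReal.toReal_ofReal (by positivity), ← measureReal_def, ← hv,
        finrank_euclideanSpace_fin]
    rw [hb, mul_pow, hβn, hxn]
    apply le_of_eq
    field_simp)
  refine le_trans ?_ hst
  have hNpos : (0:ℝ) < N := by exact_mod_cast hN1
  have hNM : (N : ℝ) ≤ M * x / r := by
    refine hNle.trans ?_
    have : 1 ≤ (1 / γ) * x / r := by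
      rw [le_div_iff₀ hr, one_div, inv_mul_eq_div, le_div_iff₀ hγpos]; linarith
    calc β * x / r + 1 ≤ β * x / r + (1 / γ) * x / r := by linarith
      _ = M * x / r := by rw [hM]; ring
  set s := r / (2 ^ n * 8 * M * x) with hs
  have hspos : 0 ≤ s := by positivity
  have h2n : (1:ℝ) ≤ 2 ^ n := one_le_pow₀ (by norm_num)
  have hsN : 2 ^ n * s ≤ 1 / (8 * N) := by
    rw [le_div_iff₀ (by positivity)]
    calc 2 ^ n * s * (8 * N) ≤ 2 ^ n * s * (8 * (M * x / r)) := by gcongr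
      _ = 1 := by rw [hs]; field_simp
  have hs1 : s ≤ 1 := by
    have : 1 / (8 * (N:ℝ)) ≤ 1 := by
      rw [div_le_one (by positivity)]
      have : (1:ℝ) ≤ N := by exact_mod_cast hN1
      linarith
    nlinarith
  have e : x + 2 * (1 / (2 ^ n * 16 * M)) * r = x * (1 + s) := by
    rw [hs]; field_simp; ring
  rw [e, mul_pow, hxn]
  have := one_add_pow_bound n s hspos hs1
  gcongr
  linarith

end steps

/-- Density growth for minimizers: (i) for every `n ≥ 1`, `r > 0` and `ω_o > 0` there is
`c_* > 0`, depending only on `n`, `r`, `ω_o`, for which the density growth estimate holds;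
(ii) for `n = 1` the constant `c_*` can be taken absolute, independent of `r` and `ω_o`;
(iii) for every `c̲ > 0` there is `c_* > 0` depending only on `n` and `c̲` for which the
estimate holds whenever `ω_o ≥ c̲ rⁿ`. -/
theorem density_growth_minimizers :
    (∀ n : ℕ, 1 ≤ n → ∀ r : ℝ, 0 < r → ∀ ωo : ℝ, 0 < ωo →
      ∃ c : ℝ, 0 < c ∧ DensityGrowth n r ωo c) ∧
    (∃ c : ℝ, 0 < c ∧ ∀ r : ℝ, 0 < r → ∀ ωo : ℝ, 0 < ωo → DensityGrowth 1 r ωo c) ∧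
    (∀ n : ℕ, 1 ≤ n → ∀ cbar : ℝ, 0 < cbar → ∃ c : ℝ, 0 < c ∧
      ∀ r : ℝ, 0 < r → ∀ ωo : ℝ, 0 < ωo → cbar * r ^ n ≤ ωo → DensityGrowth n r ωo c) := by
  have h3 : ∀ n : ℕ, 1 ≤ n → ∀ cbar : ℝ, 0 < cbar → ∃ c : ℝ, 0 < c ∧
      ∀ r : ℝ, 0 < r → ∀ ωo : ℝ, 0 < ωo → cbar * r ^ n ≤ ωo → DensityGrowth n r ωo c := by
    intro n hn cbar hcb
    obtain ⟨c, hc, h⟩ := step_const hn cbar hcb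
    refine ⟨c, hc, fun r hr ωo hω hle => iterate_lemma hn hr hω hc ?_⟩
    intro E hE R hR hmin hge
    exact h r hr E hE R hR hmin (hle.trans hge)
  refine ⟨?_, ?_, h3⟩
  · intro n hn r hr ωo hω
    obtain ⟨c, hc, h⟩ := h3 n hn (ωo / r ^ n) (by positivity)
    exact ⟨c, hc, h r hr ωo hω (by rw [div_mul_cancel₀ _ (by positivity)])⟩
  · obtain ⟨c, hc, h⟩ := step_const (le_refl 1) (1 / 2) (by norm_num)
    refine ⟨min c (1 / 4), by positivity, fun r hr ωo hω =>
      iterate_lemma (le_refl 1) hr hω (by positivity) ?_⟩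
    intro E hE R hR hmin hge
    by_cases hcase : 1 / 2 * r ^ 1 ≤ volume.real (E ∩ ball 0 R)
    · refine le_trans ?_ (h r hr E hE R hR hmin hcase)
      have : min c (1 / 4) ≤ c := min_le_left _ _
      gcongr
    · have h2 := (step_lemma (le_refl 1) hr hR hE hmin (hω.trans_le hge)).2
      have hv : volume.real (ball (0 : EuclideanSpace ℝ (Fin 1)) (r / 2)) = r := by
        rw [measureReal_def, EuclideanSpace.volume_ball]
        have hg : Real.Gamma (3 / 2) = √Real.pi / 2 := by
          have := Real.Gamma_add_one (s := 1 / 2) (by norm_num)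
          rw [Real.Gamma_one_half_eq] at this
          norm_num at this
          rw [this]; ring
        have hpi : 0 < √Real.pi := Real.sqrt_pos.2 Real.pi_pos
        simp only [Fintype.card_fin, pow_one, Nat.cast_one]
        rw [show (1 / 2 + 1 : ℝ) = 3 / 2 by norm_num, hg, ENNReal.toReal_mul,
          ENNReal.toReal_ofReal (by positivity), ENNReal.toReal_ofReal (by positivity)]
        field_simp
      rw [hv] at h2
      push Not at hcase
      have hm : min c (1 / 4) ≤ 1 / 4 := min_le_right _ _
      simp only [Nat.cast_one, div_one, Real.rpow_one, pow_one] at hcase ⊢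
      nlinarith
end
end
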